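/- arXiv:1404.4558 — 2 statements merged into one kernel-verified Lean document; each statement's English description precedes it below -/
import Mathlib

section
/- Let G be a group of exponent 4 (i.e., g^4 = 1 for all g in G) and let b be an element of G such that b^2 lies in R_2(G). Then [a, b, b] lies in R_2(G) for every a in G. -/
/-- Left-normed commutator `[a,b] = a⁻¹ * b⁻¹ * a * b`. -/
def lcomm {G : Type*} [Group G] (a b : G) : G := a⁻¹ * b⁻¹ * a * b

/-- The set of right 2-Engel elements of `G`:
`R₂(G) = {a ∈ G : [a,x,x] = 1 for all x ∈ G}`. -/
def R2 (G : Type*) [Group G] : Set G := {a | ∀ x : G, lcomm (lcomm a x) x = 1}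

open scoped commutatorElement

/-- Products of the shape `k₀ g k₁ g ⋯ g kₘ` with all `kᵢ` in `K`. -/
def gProducts {G : Type*} [Group G] (K : Subgroup G) (g : G) : ℕ → Set G
  | 0 => K
  | m + 1 => {x | ∃ w ∈ gProducts K g m, ∃ k ∈ K, x = w * g * k}

section Sanov

variable {G : Type*} [Group G] {K : Subgroup G} {g : G}

lemma gProducts_mul_mem {m : ℕ} {x k : G} (hx : x ∈ gProducts K g m) (hk : k ∈ K) :
    x * k ∈ gProducts K g m := by
  cases m with
  | zero => exact K.mul_mem hx hk
  | succ m =>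
    obtain ⟨w, hw, l, hl, rfl⟩ := hx
    exact ⟨w, hw, l * k, K.mul_mem hl hk, by group⟩

lemma gProducts_finite [Finite K] (m : ℕ) : (gProducts K g m).Finite := by
  induction m with
  | zero => exact Set.toFinite (K : Set G)
  | succ m ih =>
    refine ((ih.prod (Set.toFinite (K : Set G))).image fun p : G × G => p.1 * g * p.2).subset ?_
    rintro _ ⟨w, hw, k, hk, rfl⟩
    exact ⟨(w, k), ⟨hw, hk⟩, rfl⟩

/-- The last letter of a shortest product can be chosen in many ways. -/
lemma le_ncard_last_letters [Finite K] (hexp : ∀ x : G, x ^ 4 = 1) (hg : g ^ 2 ∈ K) (m : ℕ) :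
    ∀ x ∈ gProducts K g (m + 1), (∀ j < m + 1, x ∉ gProducts K g j) →
      m + 1 ≤ {e : G | e ∈ K ∧ x * e⁻¹ * g⁻¹ ∈ gProducts K g m}.ncard := by
  have hfin : ∀ (m : ℕ) (x : G), {e : G | e ∈ K ∧ x * e⁻¹ * g⁻¹ ∈ gProducts K g m}.Finite :=
    fun m x => (Set.toFinite (K : Set G)).subset fun e he => he.1
  induction m with
  | zero =>
    rintro x ⟨w, hw, k, hk, rfl⟩ -
    exact (Set.ncard_pos (hfin _ _)).2 ⟨k, hk, by simpa [mul_assoc] using hw⟩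
  | succ m ih =>
    rintro x ⟨w, hw, c, hc, rfl⟩ hirr
    have hw' : ∀ j < m + 1, w ∉ gProducts K g j := fun j hj hwj =>
      hirr (j + 1) (by omega) ⟨w, hwj, c, hc, rfl⟩
    have hE := ih w hw hw'
    set E := {e : G | e ∈ K ∧ w * e⁻¹ * g⁻¹ ∈ gProducts K g m} with hEdef
    have h1 : (1 : G) ∉ E := by
      rintro ⟨-, h⟩
      refine hirr m (by omega) ?_
      have := gProducts_mul_mem h (K.mul_mem hg hc)
      simpa [pow_two, mul_assoc] using this
    have hEfin : E.Finite := hfin m w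
    have hcE : c ∉ (fun e : G => e⁻¹ * c) '' E := by
      rintro ⟨e, he, hec⟩
      have : e = 1 := by simpa using hec
      exact h1 (this ▸ he)
    have hcard : (insert c ((fun e : G => e⁻¹ * c) '' E)).ncard = E.ncard + 1 := by
      rw [Set.ncard_insert_of_notMem hcE (hEfin.image _), Set.ncard_image_of_injective]
      intro e f hef
      simpa using hef
    calc m + 1 + 1 ≤ E.ncard + 1 := by omega
      _ = _ := hcard.symm
      _ ≤ _ := Set.ncard_le_ncard ?_ (hfin _ _)
    refine Set.insert_subset ⟨hc, by simpa [mul_assoc] using hw⟩ ?_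
    rintro _ ⟨e, ⟨heK, he⟩, rfl⟩
    refine ⟨K.mul_mem (K.inv_mem heK) hc, w * e⁻¹ * g⁻¹ * e⁻¹, gProducts_mul_mem he (K.inv_mem heK),
      (g ^ 2)⁻¹ * e⁻¹ * (g ^ 2)⁻¹, K.mul_mem (K.mul_mem (K.inv_mem hg) (K.inv_mem heK))
        (K.inv_mem hg), ?_⟩
    have h4 : e * g * e * g * e * g * e * g = 1 := by
      have := hexp (e * g)
      simpa [pow_succ, mul_assoc] using this
    have h5 : e * g * e = (g * e * g * e * g)⁻¹ := by
      rw [eq_inv_iff_mul_eq_one]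
      simpa [mul_assoc] using h4
    have h6 : g * e = e⁻¹ * (g * e * g * e * g)⁻¹ := by rw [← h5]; group
    calc w * g * c * (e⁻¹ * c)⁻¹ * g⁻¹ = w * (g * e) * g⁻¹ := by group
      _ = _ := by rw [h6]; group

/-- Sanov's extension step: adjoining to a finite subgroup `K` an element whose square lies in `K`
gives a finite subgroup, provided the ambient group has exponent 4. -/
lemma finite_closure_insert_of_sq_mem [Finite K] (hexp : ∀ x : G, x ^ 4 = 1) (hg : g ^ 2 ∈ K) :
    Finite (Subgroup.closure (insert g (K : Set G))) := by
  have hred : ∀ m, ∀ x ∈ gProducts K g m, ∃ j ≤ Nat.card K, x ∈ gProducts K g j := by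
    intro m
    induction m using Nat.strong_induction_on with
    | _ m ih =>
      intro x hx
      by_cases h : ∃ j < m, x ∈ gProducts K g j
      · obtain ⟨j, hj, hxj⟩ := h
        exact ih j hj x hxj
      · push Not at h
        refine ⟨m, ?_, hx⟩
        cases m with
        | zero => exact Nat.zero_le _
        | succ m =>
          refine (le_ncard_last_letters hexp hg m x hx h).trans ?_
          rw [← Nat.card_coe_set_eq]
          exact Nat.card_mono (Set.toFinite (K : Set G)) fun e he => he.1
  have hsub : (Subgroup.closure (insert g (K : Set G)) : Set G) ⊆
      ⋃ j ∈ Set.Iic (Nat.card K), gProducts K g j := by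
    intro x hx
    suffices ∃ m, x ∈ gProducts K g m by
      obtain ⟨m, hm⟩ := this
      obtain ⟨j, hj, hxj⟩ := hred m x hm
      exact Set.mem_biUnion hj hxj
    have hxg : ∀ x, (∃ m, x ∈ gProducts K g m) → ∃ m, x * g ∈ gProducts K g m := by
      rintro x ⟨m, hm⟩
      exact ⟨m + 1, x, hm, 1, K.one_mem, by group⟩
    induction hx using Subgroup.closure_induction_right with
    | one => exact ⟨0, K.one_mem⟩
    | mul_right x hx y hy ih =>
      rcases hy with rfl | hy
      · exact hxg x ih
      · obtain ⟨m, hm⟩ := ih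
        exact ⟨m, gProducts_mul_mem hm hy⟩
    | mul_inv_cancel x hx y hy ih =>
      rcases hy with rfl | hy
      · obtain ⟨m, hm⟩ := hxg x ih
        refine ⟨m, ?_⟩
        have := gProducts_mul_mem hm (K.inv_mem hg)
        simpa [pow_two, mul_assoc] using this
      · obtain ⟨m, hm⟩ := ih
        exact ⟨m, gProducts_mul_mem hm (K.inv_mem hy)⟩
  exact ((Set.finite_Iic _).biUnion fun j _ => gProducts_finite j).subset hsub

/-- Sanov: groups of exponent 4 are locally finite. -/
theorem finite_closure_of_exponent_four (hexp : ∀ x : G, x ^ 4 = 1) {S : Set G} (hS : S.Finite) :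
    Finite (Subgroup.closure S) := by
  induction S, hS using Set.Finite.induction_on with
  | empty => rw [Subgroup.closure_empty]; infer_instance
  | @insert g S _ _ ih =>
    have h1 := finite_closure_insert_of_sq_mem (K := Subgroup.closure S) (g := g ^ 2) hexp
      (by rw [← pow_mul, hexp]; exact Subgroup.one_mem _)
    have h2 := finite_closure_insert_of_sq_mem
      (K := Subgroup.closure (insert (g ^ 2) (Subgroup.closure S : Set G))) (g := g) hexp
      (Subgroup.subset_closure (Set.mem_insert _ _))
    refine Set.Finite.subset (s := (Subgroup.closure (insert g
      (Subgroup.closure (insert (g ^ 2) (Subgroup.closure S : Set G)) : Set G)) : Set G)) h2 ?_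
    rw [SetLike.coe_subset_coe, Subgroup.closure_le]
    rintro x (rfl | hx)
    · exact Subgroup.subset_closure (Set.mem_insert _ _)
    · exact Subgroup.subset_closure (Set.mem_insert_of_mem _ (Subgroup.subset_closure
        (Set.mem_insert_of_mem _ (Subgroup.subset_closure hx))))

end Sanov

/-- An element is *tame* if its square commutes with all its conjugates and with all squares. -/
structure IsTame {G : Type*} [Group G] (u : G) : Prop where
  sq_conj : ∀ g, Commute (u ^ 2) (g * u * g⁻¹)
  sq_sq : ∀ x, Commute (u ^ 2) (x ^ 2)

section Tame

variable {G : Type*} [Group G] {u : G}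

lemma IsTame.of_sq_eq_one (h : u ^ 2 = 1) : IsTame u :=
  ⟨fun _ => h ▸ Commute.one_left _, fun _ => h ▸ Commute.one_left _⟩

lemma IsTame.map {G' : Type*} [Group G'] (hu : IsTame u) (f : G →* G')
    (hf : Function.Surjective f) : IsTame (f u) := by
  refine ⟨fun g => ?_, fun x => ?_⟩
  · obtain ⟨g, rfl⟩ := hf g
    simpa using (hu.sq_conj g).map f
  · obtain ⟨x, rfl⟩ := hf x
    simpa using (hu.sq_sq x).map f

lemma IsTame.of_injective {G' : Type*} [Group G'] (f : G →* G') (hf : Function.Injective f)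
    (hu : IsTame (f u)) : IsTame u := by
  refine ⟨fun g => hf ?_, fun x => hf ?_⟩
  · simpa using (hu.sq_conj (f g)).eq
  · simpa using (hu.sq_sq (f x)).eq

/-- If `u ^ 2` is right 2-Engel in a group of exponent 4, then `u` is tame. -/
lemma isTame_of_sq_engel (hexp : ∀ g : G, g ^ 4 = 1)
    (hu : ∀ x, Commute ((u ^ 2)⁻¹ * x⁻¹ * u ^ 2 * x) x) : IsTame u := by
  have hzz : u ^ 2 * u ^ 2 = 1 := by rw [← pow_add]; exact hexp u
  have hbz : Commute (u ^ 2) u := (Commute.refl u).pow_left 2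
  obtain ⟨z, hz⟩ : ∃ z, u ^ 2 = z := ⟨_, rfl⟩
  rw [hz] at hu hzz hbz
  have hzi : z⁻¹ = z := inv_eq_of_mul_eq_one_left hzz
  have hzx : ∀ x, Commute z (x⁻¹ * z * x) := fun x => by
    have h1 := hu x
    have h2 := hu (z * x)
    have e : z⁻¹ * (z * x)⁻¹ * z * (z * x) = z⁻¹ * x⁻¹ * z * x := by group
    rw [e] at h2
    have h3 : Commute (z⁻¹ * x⁻¹ * z * x) z := by simpa using h2.mul_right h1.inv_right
    have h5 := (Commute.refl z).mul_right h3.symm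
    simpa [mul_assoc] using h5
  have hsq : ∀ x, Commute z (x ^ 2) := fun x => by
    have h1 : x⁻¹ * (z⁻¹ * x⁻¹ * z * x) * x = z⁻¹ * x⁻¹ * z * x := by
      rw [mul_assoc, (hu x).eq, inv_mul_cancel_left]
    have h2 : x⁻¹ * x⁻¹ * z * x * x = (x⁻¹ * z * x) * (z⁻¹ * (x⁻¹ * z * x)) := by
      rw [← mul_assoc z⁻¹, ← mul_assoc z⁻¹, ← h1]; group
    rw [(hzx x).inv_left.eq, hzi, ← mul_assoc] at h2
    have h3 : x⁻¹ * x⁻¹ * z * x * x = z := by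
      rw [h2]
      calc x⁻¹ * z * x * (x⁻¹ * z * x) * z = x⁻¹ * (z * z) * x * z := by group
        _ = z := by rw [hzz]; group
    have h4 : z * (x * x) = x * x * z := by
      conv_rhs => rw [← h3]
      group
    rw [pow_two]
    exact h4
  have hc : ∀ w, w * z * w⁻¹ = w⁻¹ * z * w := fun w =>
    calc w * z * w⁻¹ = w⁻¹ * (w ^ 2 * z) * w⁻¹ := by group
      _ = w⁻¹ * z * w := by rw [← (hsq w).eq]; group
  refine ⟨fun g => ?_, fun x => hz ▸ hsq x⟩
  have h1 : u * (g⁻¹ * z * g) * u⁻¹ = g⁻¹ * z * g :=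
    calc u * (g⁻¹ * z * g) * u⁻¹ = (g * u⁻¹)⁻¹ * z * (g * u⁻¹) := by group
      _ = g * (u⁻¹ * (z * u)) * g⁻¹ := by rw [← hc]; group
      _ = g⁻¹ * z * g := by rw [hbz.eq, inv_mul_cancel_left, hc]
  have h2 : u * (g⁻¹ * z * g) = (g⁻¹ * z * g) * u := by rwa [mul_inv_eq_iff_eq_mul] at h1
  rw [hz]
  calc z * (g * u * g⁻¹) = g * ((g⁻¹ * z * g) * u) * g⁻¹ := by group
    _ = (g * u * g⁻¹) * z := by rw [← h2]; group

/-- The conjugate `g * u * g⁻¹`. -/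
def cj (u g : G) : G := g * u * g⁻¹

@[simp] lemma cj_one : cj u 1 = u := by simp [cj]

lemma conj_cj (k g : G) : k * cj u g * k⁻¹ = cj u (k * g) := by simp only [cj]; group

lemma cj_sq (g : G) : cj u g ^ 2 = g * u ^ 2 * g⁻¹ := by simp only [cj, pow_two]; group

lemma conj_commutator (k x y : G) : k * ⁅x, y⁆ * k⁻¹ = ⁅k * x * k⁻¹, k * y * k⁻¹⁆ := by
  simp only [commutatorElement_def]; group

lemma conj_commutator_cj (k g h : G) :
    k * ⁅cj u g, cj u h⁆ * k⁻¹ = ⁅cj u (k * g), cj u (k * h)⁆ := by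
  rw [conj_commutator, conj_cj, conj_cj]

/-- Four consecutive conjugates multiply to 1 in a group of exponent 4. -/
lemma cj_block (hexp : ∀ g : G, g ^ 4 = 1) (c h : G) :
    cj u h * cj u (c * h) * cj u (c ^ 2 * h) * cj u (c ^ 3 * h) = 1 := by
  have h1 := hexp (cj u h * c)
  have h2 := hexp c
  calc _ = (cj u h * c) ^ 4 * (c ^ 4)⁻¹ := by simp only [cj, pow_succ, pow_zero]; group
    _ = 1 := by rw [h1, h2]; group

namespace IsTame

lemma commute_sq_cj (hu : IsTame u) (g h : G) : Commute (cj u g ^ 2) (cj u h) := by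
  have := (hu.sq_conj (g⁻¹ * h)).conj g
  convert this using 1 <;> simp only [cj, pow_two] <;> group

lemma cj_sq_mul (hu : IsTame u) (g x : G) : cj u (g * x ^ 2) ^ 2 = cj u g ^ 2 := by
  have := (hu.sq_sq x).eq
  rw [cj_sq, cj_sq]
  calc g * x ^ 2 * u ^ 2 * (g * x ^ 2)⁻¹ = g * (x ^ 2 * u ^ 2) * (x ^ 2)⁻¹ * g⁻¹ := by group
    _ = _ := by rw [← this]; group

lemma commute_cj_sq (hexp : ∀ g : G, g ^ 4 = 1) (hu : IsTame u) (x : G) :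
    Commute u (cj u (x ^ 2)) := by
  have h1 := hexp (u * x ^ 2)
  have hz := hu.cj_sq_mul 1 x
  rw [one_mul, cj_one] at hz
  set v := cj u (x ^ 2) with hv
  have hx : (x ^ 2)⁻¹ = x ^ 2 := inv_eq_of_mul_eq_one_left (by rw [← pow_add]; exact hexp x)
  have h2 : u * v * (u * v) = 1 := by
    rw [← h1, hv, cj, hx]
    simp only [pow_succ (u * _), pow_zero, one_mul, mul_assoc]
  calc u * v = u * (u ^ 4)⁻¹ * v := by rw [hexp]; simp
    _ = u * (u ^ 2 * v ^ 2)⁻¹ * v := by rw [hz, ← pow_add]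
    _ = u * (v ^ 2 * u ^ 2)⁻¹ * v := by rw [hz]
    _ = u⁻¹ * (u * v * (u * v)) * v⁻¹ := by rw [h2]; group
    _ = v * u := by group

/-- The main relations between `u` and a conjugate. -/
lemma commutator_cj (hexp : ∀ g : G, g ^ 4 = 1) (hu : IsTame u) (x : G) :
    ⁅u, cj u x⁆ ^ 2 = 1 ∧ Commute ⁅u, cj u x⁆ u ∧ x * ⁅u, cj u x⁆ * x⁻¹ = ⁅u, cj u x⁆ := by
  have b1 := cj_block (u := u) hexp x 1
  have b2 := cj_block (u := u) hexp x⁻¹ 1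
  have x3 : x⁻¹ = x ^ 3 := by rw [inv_eq_iff_mul_eq_one, ← pow_succ']; exact hexp x
  have x2 : (x ^ 2)⁻¹ = x ^ 2 := inv_eq_of_mul_eq_one_left (by rw [← pow_add]; exact hexp x)
  have e1 : (x⁻¹) ^ 2 = x ^ 2 := by rw [inv_pow, x2]
  have e2 : (x⁻¹) ^ 3 = x := by rw [inv_pow, ← x3, inv_inv]
  rw [e1, e2, x3] at b2
  simp only [mul_one, cj_one] at b1 b2
  have c02 := hu.commute_cj_sq hexp x
  have c13 : Commute (cj u x) (cj u (x ^ 3)) := by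
    have := c02.conj x
    rwa [conj_cj, ← pow_succ'] at this
  have c1 : x * cj u x * x⁻¹ = cj u (x ^ 2) := by rw [conj_cj, pow_two]
  have c0 : x * u * x⁻¹ = cj u x := rfl
  have z01 := hu.commute_sq_cj 1 x
  have z10 := hu.commute_sq_cj x 1
  rw [cj_one] at z01 z10
  rw [conj_commutator, c0, c1]
  clear c0 c1
  generalize cj u x = v at *
  generalize cj u (x ^ 2) = w at *
  generalize cj u (x ^ 3) = t at *
  have t1 : t = (u * v * w)⁻¹ := eq_inv_of_mul_eq_one_right b1
  have t2 : t = (w * v * u)⁻¹ := by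
    calc t = u⁻¹ * (u * t * w * v) * v⁻¹ * w⁻¹ := by group
      _ = _ := by rw [b2]; group
  have s0 : u * v * w = w * v * u := inv_injective (t1.symm.trans t2)
  have s1 : v * (u * v * w) = u * v * w * v := by
    have := c13.inv_right.eq
    rwa [t1, inv_inv] at this
  have s2 : v * (w⁻¹ * u) = w⁻¹ * u * v :=
    calc v * (w⁻¹ * u) = v * (u * w⁻¹) := by rw [c02.inv_right.eq]
      _ = w⁻¹ * (w * v * u) * w⁻¹ := by group
      _ = w⁻¹ * u * v := by rw [← s0]; group
  have k1 : ⁅u, v⁆ = ⁅w, v⁆ := by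
    rw [commutatorElement_def, commutatorElement_def]
    calc u * v * u⁻¹ * v⁻¹ = w * (w⁻¹ * u * v) * u⁻¹ * v⁻¹ := by group
      _ = w * v * w⁻¹ * v⁻¹ := by rw [← s2]; group
  have k2 : v * u * v * u = u * v * u * v :=
    calc v * u * v * u = v * (u * v * w) * (w⁻¹ * u) := by group
      _ = u * v * w * (v * (w⁻¹ * u)) := by rw [s1]; group
      _ = u * v * u * v := by rw [s2]; group
  have k3 : Commute (u * v * u * v) u := by
    calc u * v * u * v * u = u * (v * u * v * u) := by group
      _ = u * (u * v * u * v) := by rw [k2]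
  have k4 : ⁅u, v⁆ = (u * v * u * v) * (u ^ 2)⁻¹ * (v ^ 2)⁻¹ := by
    calc u * v * u⁻¹ * v⁻¹ = u * v * u * ((u ^ 2)⁻¹ * v) * (v ^ 2)⁻¹ := by group
      _ = _ := by rw [z01.inv_left.eq]; group
  have k5 : Commute ⁅u, v⁆ u := by
    rw [k4]
    exact (k3.mul_left ((Commute.refl u).pow_left 2).inv_left).mul_left z10.inv_left
  have k6 : ⁅u, v⁆ ^ 2 = 1 := by
    have h1 : u * (⁅u, v⁆ * v) * u⁻¹ = ⁅u, v⁆ * (⁅u, v⁆ * v) := by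
      rw [← mul_assoc, ← k5.eq, commutatorElement_def]; group
    have h2 : u * (⁅u, v⁆ * v) * u⁻¹ = v :=
      calc u * (⁅u, v⁆ * v) * u⁻¹ = u ^ 2 * v * (u ^ 2)⁻¹ := by
            rw [commutatorElement_def, pow_two]; group
        _ = v := by rw [z01.eq]; group
    rw [h2, ← mul_assoc, ← pow_two] at h1
    exact (right_eq_mul.1 h1)
  refine ⟨k6, k5, ?_⟩
  rw [← commutatorElement_inv, ← k1, inv_eq_iff_mul_eq_one, ← pow_two, k6]

variable (hexp : ∀ g : G, g ^ 4 = 1) (hu : IsTame u)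
include hexp hu

lemma commutator_sq (g h : G) : ⁅cj u g, cj u h⁆ ^ 2 = 1 := by
  have := conj_commutator_cj (u := u) g 1 (g⁻¹ * h)
  rw [mul_one, mul_inv_cancel_left, cj_one] at this
  rw [← this, conj_pow, (hu.commutator_cj hexp _).1]; group

lemma commutator_inv (g h : G) : ⁅cj u g, cj u h⁆⁻¹ = ⁅cj u g, cj u h⁆ :=
  inv_eq_of_mul_eq_one_left (by rw [← pow_two, hu.commutator_sq hexp])

lemma commutator_comm (g h : G) : ⁅cj u g, cj u h⁆ = ⁅cj u h, cj u g⁆ := by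
  rw [← commutatorElement_inv, hu.commutator_inv hexp]

lemma conj_q (g : G) : g * ⁅u, cj u g⁆ * g⁻¹ = ⁅u, cj u g⁆ := (hu.commutator_cj hexp g).2.2

lemma commute_q_left (g : G) : Commute ⁅u, cj u g⁆ u := (hu.commutator_cj hexp g).2.1

lemma q_inv (g : G) : ⁅u, cj u g⁻¹⁆ = ⁅u, cj u g⁆ := by
  have h1 := conj_commutator_cj (u := u) g⁻¹ g 1
  have h2 := hu.conj_q hexp g
  have h3 := hu.commutator_comm hexp g 1
  rw [mul_one, inv_mul_cancel] at h1
  rw [cj_one] at h1 h3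
  rw [← h1, h3, inv_inv]
  calc _ = g⁻¹ * (g * ⁅u, cj u g⁆ * g⁻¹) * g := by rw [h2]
    _ = _ := by group

end IsTame

end Tame

section ClassTwo

variable {K : Type*} [Group K]

/-- All commutators are central. -/
def IsClassTwo (K : Type*) [Group K] : Prop := ∀ x y z : K, Commute ⁅x, y⁆ z

namespace IsClassTwo

variable (hK : IsClassTwo K)
include hK

lemma commutator_mul_right (x y z : K) : ⁅x, y * z⁆ = ⁅x, y⁆ * ⁅x, z⁆ := by
  have := (hK x z y).eq
  calc ⁅x, y * z⁆ = ⁅x, y⁆ * (y * ⁅x, z⁆ * y⁻¹) := by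
        simp only [commutatorElement_def]; group
    _ = _ := by rw [← this]; group

lemma commutator_mul_left (x y z : K) : ⁅x * y, z⁆ = ⁅x, z⁆ * ⁅y, z⁆ := by
  rw [← commutatorElement_inv, hK.commutator_mul_right, mul_inv_rev, commutatorElement_inv,
    commutatorElement_inv, (hK _ _ _).eq]

lemma commutator_inv_right (x y : K) : ⁅x, y⁻¹⁆ = ⁅x, y⁆⁻¹ := by
  rw [eq_inv_iff_mul_eq_one, ← hK.commutator_mul_right, inv_mul_cancel, commutatorElement_one_right]

lemma commutator_inv_left (x y : K) : ⁅x⁻¹, y⁆ = ⁅x, y⁆⁻¹ := by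
  rw [eq_inv_iff_mul_eq_one, ← hK.commutator_mul_left, inv_mul_cancel, commutatorElement_one_left]

lemma interleave {h₀ h₁ h₂ h₃ k₀ k₁ k₂ k₃ : K} (hh : h₀ * h₁ * h₂ * h₃ = 1)
    (hk : k₀ * k₁ * k₂ * k₃ = 1) (hhk : h₀ * k₀ * h₁ * k₁ * h₂ * k₂ * h₃ * k₃ = 1) :
    ⁅k₂, h₃⁆ * (⁅k₁, h₀⁆ * ⁅k₁, h₁⁆)⁻¹ * ⁅k₀, h₀⁆⁻¹ = 1 := by
  have sw : ∀ x y : K, x * y = ⁅x, y⁆ * y * x := fun x y => by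
    rw [commutatorElement_def]; group
  have e1 : h₂ * h₃ = (h₀ * h₁)⁻¹ := eq_inv_of_mul_eq_one_right (by rw [← hh]; group)
  have e2 : h₁ * h₂ * h₃ = h₀⁻¹ := eq_inv_of_mul_eq_one_right (by rw [← hh]; group)
  rw [← hK.commutator_mul_right, ← hK.commutator_inv_right, ← hK.commutator_inv_right, ← e1, ← e2]
  have c2 := fun z => (hK k₂ h₃ z).eq
  have c1 := fun z => (hK k₁ (h₂ * h₃) z).eq
  have c0 := fun z => (hK k₀ (h₁ * h₂ * h₃) z).eq
  have s2 := sw k₂ h₃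
  have s1 := sw k₁ (h₂ * h₃)
  have s0 := sw k₀ (h₁ * h₂ * h₃)
  generalize ⁅k₂, h₃⁆ = d2 at *
  generalize ⁅k₁, h₂ * h₃⁆ = d1 at *
  generalize ⁅k₀, h₁ * h₂ * h₃⁆ = d0 at *
  rw [← hhk]
  symm
  calc h₀ * k₀ * h₁ * k₁ * h₂ * k₂ * h₃ * k₃ = h₀ * k₀ * h₁ * k₁ * h₂ * (k₂ * h₃) * k₃ := by group
    _ = (h₀ * k₀ * h₁ * k₁ * h₂ * d2) * h₃ * k₂ * k₃ := by rw [s2]; group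
    _ = d2 * h₀ * k₀ * h₁ * (k₁ * (h₂ * h₃)) * k₂ * k₃ := by rw [← c2]; group
    _ = d2 * (h₀ * k₀ * h₁ * d1) * h₂ * h₃ * k₁ * k₂ * k₃ := by rw [s1]; group
    _ = d2 * d1 * h₀ * (k₀ * (h₁ * h₂ * h₃)) * k₁ * k₂ * k₃ := by rw [← c1]; group
    _ = d2 * d1 * (h₀ * d0) * (h₁ * h₂ * h₃) * (k₀ * k₁ * k₂ * k₃) := by rw [s0]; group
    _ = d2 * d1 * d0 * (h₀ * h₁ * h₂ * h₃) * (k₀ * k₁ * k₂ * k₃) := by rw [← c0]; group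
    _ = d2 * d1 * d0 := by rw [hh, hk]; group

end IsClassTwo

end ClassTwo

section Normal

variable {G : Type*} [Group G] {u : G}

lemma cj_mem (u g : G) : cj u g ∈ Subgroup.normalClosure {u} :=
  Subgroup.normalClosure_normal.conj_mem _ (Subgroup.subset_normalClosure (Set.mem_singleton _)) g

/-- The conjugate `g * u * g⁻¹` as an element of the normal closure of `u`. -/
def cjN (u g : G) : Subgroup.normalClosure {u} := ⟨cj u g, cj_mem u g⟩

lemma closure_cj (u : G) : Subgroup.closure (Set.range (cj u)) = Subgroup.normalClosure {u} := by
  rw [Subgroup.normalClosure]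
  congr 1
  ext x
  simp [Group.mem_conjugatesOfSet_iff, isConj_iff, cj]

/-- The relation between commutators of conjugates that comes from the exponent 4 law applied to
`u * (a * u * a⁻¹) * x`. -/
lemma IsTame.interleave (hexp : ∀ g : G, g ^ 4 = 1) (hu : IsTame u)
    (hc : IsClassTwo (Subgroup.normalClosure {u})) (x a : G) :
    ⁅cj u a, u⁆ * ⁅cj u (x * a), u⁆ * ⁅cj u (x * a), cj u x⁆ *
      ⁅cj u (x ^ 2 * a), cj u (x ^ 3)⁆ = 1 := by
  have hb := fun g : G => cj_block (u := u) hexp x g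
  have b1 := hb 1
  simp only [mul_one] at b1
  have h4 :
      cj u 1 * cj u a * cj u x * cj u (x * a) * cj u (x ^ 2) * cj u (x ^ 2 * a) * cj u (x ^ 3) *
      cj u (x ^ 3 * a) = 1 := by
    calc _ = (u * cj u a * x) ^ 4 * (x ^ 4)⁻¹ := by
          simp only [cj, pow_succ, pow_zero]; group
      _ = 1 := by rw [hexp, hexp]; group
  have h5 : ⁅cj u (x ^ 2 * a), cj u (x ^ 3)⁆ * (⁅cj u (x * a), cj u 1⁆ * ⁅cj u (x * a), cj u x⁆)⁻¹ *
      ⁅cj u a, cj u 1⁆⁻¹ = 1 :=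
    congrArg Subtype.val (hc.interleave (h₀ := cjN u 1) (h₁ := cjN u x) (h₂ := cjN u (x ^ 2))
    (h₃ := cjN u (x ^ 3)) (k₀ := cjN u a) (k₁ := cjN u (x * a)) (k₂ := cjN u (x ^ 2 * a))
    (k₃ := cjN u (x ^ 3 * a)) (Subtype.ext b1) (Subtype.ext (hb a))
    (Subtype.ext h4))
  rw [cj_one] at h5
  rw [mul_assoc, ← mul_inv_rev, mul_inv_eq_one, ← mul_assoc] at h5
  rw [← h5, ← pow_two, hu.commutator_sq hexp]

end Normal

section ClassThree

variable {G : Type*} [Group G] {u : G}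

lemma conj_eq_commutator_mul (x y : G) : x * y = ⁅x, y⁆ * y * x := by
  rw [commutatorElement_def]; group

/-- The Jacobi identity for three elements in a suitably nilpotent situation. -/
lemma commutator_jacobi {A B C : G} (hAB : Commute ⁅A, B⁆ ⁅A, C⁆) (hAB' : Commute ⁅A, B⁆ ⁅B, C⁆)
    (hBC : Commute ⁅A, C⁆ ⁅B, C⁆)
    (hB : Commute ⁅B, ⁅A, C⁆⁆ ⁅A, B⁆) (hC1 : Commute ⁅⁅A, B⁆, C⁆ ⁅B, C⁆)
    (hC2 : Commute ⁅⁅A, B⁆, C⁆ ⁅A, C⁆) :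
    ⁅A, ⁅B, C⁆⁆ = ⁅B, ⁅A, C⁆⁆ * ⁅⁅A, B⁆, C⁆ := by
  have e1 := conj_eq_commutator_mul A B
  have e2 := conj_eq_commutator_mul B C
  have e3 := conj_eq_commutator_mul A C
  have e4 := conj_eq_commutator_mul A ⁅B, C⁆
  have e5 := conj_eq_commutator_mul B ⁅A, C⁆
  have e6 := conj_eq_commutator_mul ⁅A, B⁆ C
  generalize ⁅A, ⁅B, C⁆⁆ = TA at *
  generalize ⁅B, ⁅A, C⁆⁆ = TB at *
  generalize ⁅⁅A, B⁆, C⁆ = TC at *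
  generalize ⁅A, B⁆ = Q₃ at *
  generalize ⁅A, C⁆ = Q₂ at *
  generalize ⁅B, C⁆ = Q₁ at *
  have h1 : A * B * C = TA * (Q₁ * Q₂ * (C * Q₃ * B * A)) :=
    calc A * B * C = A * (B * C) := mul_assoc _ _ _
      _ = (A * Q₁) * C * B := by rw [e2]; group
      _ = TA * Q₁ * (A * C) * B := by rw [e4]; group
      _ = TA * Q₁ * Q₂ * C * (A * B) := by rw [e3]; group
      _ = _ := by rw [e1]; group
  have h2 : A * B * C = TB * TC * (Q₁ * Q₂ * (C * Q₃ * B * A)) :=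
    calc A * B * C = Q₃ * B * (A * C) := by rw [e1]; group
      _ = Q₃ * (B * Q₂) * C * A := by rw [e3]; group
      _ = (Q₃ * TB) * Q₂ * (B * C) * A := by rw [e5]; group
      _ = TB * (Q₃ * (Q₂ * Q₁)) * C * B * A := by rw [e2, ← hB.eq]; group
      _ = TB * (Q₂ * Q₁) * (Q₃ * C) * B * A := by rw [(hAB.mul_right hAB').eq]; group
      _ = TB * (Q₂ * Q₁ * TC) * C * Q₃ * B * A := by rw [e6]; group
      _ = TB * TC * (Q₂ * Q₁) * C * Q₃ * B * A := by rw [← (hC2.mul_right hC1).eq]; group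
      _ = _ := by rw [hBC.eq]; group
  exact mul_right_cancel (h1.symm.trans h2)

namespace IsTame

variable (hexp : ∀ g : G, g ^ 4 = 1) (hu : IsTame u)
  (h3 : ∀ g h k l, Commute ⁅⁅cj u g, cj u h⁆, cj u k⁆ (cj u l))
  (hR : ∀ x a, Commute (⁅cj u a, u⁆ * ⁅cj u (x * a), u⁆ * ⁅cj u (x * a), cj u x⁆ *
      ⁅cj u (x ^ 2 * a), cj u (x ^ 3)⁆) u)

include hexp hu in
/-- The commutator `⁅m * u * m⁻¹, n * u * n⁻¹⁆` only depends on `m⁻¹ * n` through inversion. -/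
lemma commutator_reflect (m n : G) : ⁅cj u (m * n⁻¹ * m), cj u m⁆ = ⁅cj u m, cj u n⁆ := by
  have h1 := conj_commutator_cj (u := u) m (n⁻¹ * m) 1
  have h2 := conj_commutator_cj (u := u) m (m⁻¹ * n) 1
  rw [cj_one] at h1 h2
  have h3 := hu.q_inv hexp (m⁻¹ * n)
  have h4 := hu.commutator_comm hexp 1
  rw [cj_one] at h4
  rw [mul_inv_rev, inv_inv, h4, h4] at h3
  rw [mul_one, ← mul_assoc] at h1
  rw [mul_inv_cancel_left, mul_one] at h2
  rw [← h1, h3, h2, hu.commutator_comm hexp]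

include h3 in
lemma commute_triple_pair (g h k m n : G) :
    Commute ⁅⁅cj u g, cj u h⁆, cj u k⁆ ⁅cj u m, cj u n⁆ := by
  rw [commutatorElement_def (cj u m)]
  have := h3 g h k
  exact (((this m).mul_right (this n)).mul_right (this m).inv_right).mul_right (this n).inv_right

include h3 in
lemma commute_pair_pair (g h m n : G) :
    Commute ⁅cj u g, cj u h⁆ ⁅cj u m, cj u n⁆ := by
  have c1 := h3 g h m n
  have c2 := h3 g h n m
  have c3 := commute_triple_pair h3 g h m g h
  have c4 := commute_triple_pair h3 g h m m n
  have c5 := commute_triple_pair h3 g h n m n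
  have c6 := h3 g h m n
  generalize cj u m = A at *
  generalize cj u n = B at *
  generalize ⁅cj u g, cj u h⁆ = Q at *
  have c7 : Commute ⁅Q, A⁆ ⁅Q, B⁆ :=
    ((c3.mul_right c6).mul_right c3.inv_right).mul_right c6.inv_right
  have : Q * ⁅A, B⁆ * Q⁻¹ = ⁅A, B⁆ := by
    calc Q * ⁅A, B⁆ * Q⁻¹ = ⁅Q, A⁆ * (A * ⁅Q, B⁆) * B * A⁻¹ * (⁅Q, A⁆⁻¹ * B⁻¹) * ⁅Q, B⁆⁻¹ := by
          simp only [commutatorElement_def]; group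
      _ = ⁅Q, A⁆ * (⁅Q, B⁆ * ⁅A, B⁆) * ⁅Q, A⁆⁻¹ * ⁅Q, B⁆⁻¹ := by
          rw [← c2.eq, c1.inv_left.inv_right.eq, commutatorElement_def A]; group
      _ = ⁅Q, B⁆ * ⁅A, B⁆ * ⁅Q, B⁆⁻¹ := by rw [(c7.mul_right c4).eq]; group
      _ = _ := by rw [c5.eq]; group
  exact mul_inv_eq_iff_eq_mul.1 this

include hexp hu h3 in
lemma triple_sq (m n : G) : ⁅⁅cj u m, cj u n⁆, u⁆ ^ 2 = 1 := by
  have h1 := commute_triple_pair h3 m n 1 m n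
  have h2 := hu.commutator_sq hexp m n
  rw [cj_one] at h1
  have h4 : ⁅⁅cj u m, cj u n⁆ ^ 2, u⁆ = ⁅⁅cj u m, cj u n⁆, u⁆ ^ 2 := by
    generalize ⁅cj u m, cj u n⁆ = Q at *
    calc ⁅Q ^ 2, u⁆ = Q * ⁅Q, u⁆ * Q⁻¹ * ⁅Q, u⁆ := by
          simp only [commutatorElement_def, pow_two]; group
      _ = _ := by rw [← h1.eq, pow_two]; group
  rw [← h4, h2, commutatorElement_one_left]

include hexp hu h3 hR in
lemma triple_shift (m n : G) :
    ⁅⁅cj u m, cj u n⁆, u⁆ = ⁅⁅cj u (n * m), cj u n⁻¹⁆, u⁆ := by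
  have h1 := hR n (n⁻¹ * m)
  have x3 : n ^ 3 = n⁻¹ := by
    rw [eq_comm, inv_eq_iff_mul_eq_one, ← pow_succ']; exact hexp n
  have e1 : n ^ 2 * (n⁻¹ * m) = n * m := by group
  have c1 := hu.commute_q_left hexp (n⁻¹ * m)
  have c2 := hu.commute_q_left hexp m
  have c3 := hu.commutator_comm hexp 1
  rw [cj_one] at c3
  rw [mul_inv_cancel_left, x3, e1, ← c3, ← c3] at h1
  have h2 : Commute (⁅cj u m, cj u n⁆ * ⁅cj u (n * m), cj u n⁻¹⁆) u := by
    have := (c1.mul_left c2).inv_left.mul_left h1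
    rwa [mul_assoc (_ * _), inv_mul_cancel_left] at this
  have c4 := commute_triple_pair h3 (n * m) n⁻¹ 1 m n
  have c5 := hu.triple_sq hexp h3 (n * m) n⁻¹
  rw [cj_one] at c4
  generalize ⁅cj u m, cj u n⁆ = Q at *
  generalize ⁅cj u (n * m), cj u n⁻¹⁆ = Q' at *
  have c6 : ⁅Q', u⁆⁻¹ = ⁅Q', u⁆ := inv_eq_of_mul_eq_one_left (by rw [← pow_two, c5])
  rw [← c6]
  refine eq_inv_of_mul_eq_one_right ?_
  rw [← commutatorElement_eq_one_iff_commute.2 h2]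
  calc ⁅Q', u⁆ * ⁅Q, u⁆ = ⁅Q', u⁆ * Q * Q⁻¹ * ⁅Q, u⁆ := by group
    _ = _ := by rw [c4.eq]; simp only [commutatorElement_def]; group

include hexp hu h3 hR

lemma triple_inv_left (m n : G) : ⁅⁅cj u m⁻¹, cj u n⁆, u⁆ = ⁅⁅cj u m, cj u n⁆, u⁆ := by
  have sh := hu.triple_shift hexp h3 hR
  have rf : ∀ m n : G, ⁅⁅cj u (n * m⁻¹ * n), cj u n⁆, u⁆ = ⁅⁅cj u m, cj u n⁆, u⁆ := fun m n => by
    rw [hu.commutator_reflect hexp, hu.commutator_comm hexp]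
  have n4 : n⁻¹ = n ^ 3 := by
    rw [inv_eq_iff_mul_eq_one, ← pow_succ']; exact hexp n
  have h1 : ∀ m, ⁅⁅cj u m, cj u n⁆, u⁆ = ⁅⁅cj u (n⁻¹ * m * n⁻¹), cj u n⁆, u⁆ := fun m => by
    have e : n * (n⁻¹ * (n⁻¹ * (n * m)⁻¹ * n⁻¹))⁻¹ * n = n⁻¹ * m * n⁻¹ := by
      conv_rhs => rw [n4]
      group
    rw [sh, ← rf (n * m), sh, inv_inv, ← rf, e]
  rw [← rf m, h1 (n * m⁻¹ * n)]
  congr 4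
  group

lemma triple_inv_right (m n : G) : ⁅⁅cj u m, cj u n⁻¹⁆, u⁆ = ⁅⁅cj u m, cj u n⁆, u⁆ := by
  rw [hu.commutator_comm hexp, hu.triple_inv_left hexp h3 hR, hu.commutator_comm hexp]

lemma triple_mul_left (m n : G) : ⁅⁅cj u (n * m), cj u n⁆, u⁆ = ⁅⁅cj u m, cj u n⁆, u⁆ := by
  rw [hu.triple_shift hexp h3 hR m, hu.triple_inv_right hexp h3 hR]

lemma triple_mul_right (m n : G) : ⁅⁅cj u (m * n), cj u n⁆, u⁆ = ⁅⁅cj u m, cj u n⁆, u⁆ := by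
  rw [← hu.triple_inv_left hexp h3 hR, mul_inv_rev, ← hu.triple_mul_left hexp h3 hR,
    mul_inv_cancel_left, hu.triple_inv_left hexp h3 hR]

lemma conj_triple (g h : G) : g * ⁅⁅cj u g, cj u h⁆, u⁆ * g⁻¹ = ⁅⁅cj u h, u⁆, cj u g⁆ := by
  have h1 : ⁅⁅cj u (g⁻¹ * h), cj u g⁻¹⁆, u⁆ = ⁅⁅cj u g, cj u h⁆, u⁆ := by
    rw [hu.triple_inv_right hexp h3 hR, ← hu.triple_mul_left hexp h3 hR, mul_inv_cancel_left,
      hu.commutator_comm hexp]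
  rw [← h1, conj_commutator, conj_commutator_cj, mul_inv_cancel_left, mul_inv_cancel, cj_one]
  rfl

lemma triple_jacobi (g h : G) : g * ⁅⁅cj u g, cj u h⁆, u⁆ * g⁻¹ =
    h * ⁅⁅cj u g, cj u h⁆, u⁆ * h⁻¹ * ⁅⁅cj u g, cj u h⁆, u⁆ := by
  have pp := commute_pair_pair h3
  have tp := commute_triple_pair h3
  have pp1 := pp g h g 1
  have pp2 := pp g h h 1
  have pp3 := pp g 1 h 1
  have tp1 := tp g h 1 h 1
  have tp2 := tp g h 1 g 1
  have tp3 := tp g 1 h g h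
  have k1 := hu.conj_triple hexp h3 hR g h
  have k2 := hu.conj_triple hexp h3 hR h g
  rw [hu.commutator_comm hexp h g] at k2
  have pp4 := hu.commutator_inv hexp h 1
  have pp5 := hu.commutator_inv hexp g 1
  have tr : ∀ m n, ⁅⁅cj u m, cj u n⁆, u⁆⁻¹ = ⁅⁅cj u m, cj u n⁆, u⁆ := fun m n =>
    inv_eq_of_mul_eq_one_left (by rw [← pow_two, hu.triple_sq hexp h3])
  rw [cj_one] at *
  have k3 : ⁅cj u g, ⁅cj u h, u⁆⁆ = g * ⁅⁅cj u g, cj u h⁆, u⁆ * g⁻¹ := by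
    rw [← commutatorElement_inv, ← k1, conj_inv, tr]
  have k4 : ⁅cj u h, ⁅cj u g, u⁆⁆ = h * ⁅⁅cj u g, cj u h⁆, u⁆ * h⁻¹ := by
    rw [← commutatorElement_inv, ← k2, conj_inv, tr]
  rw [← k3, ← k4]
  refine commutator_jacobi pp1 pp2 pp3 ?_ tp1 tp2
  rw [← commutatorElement_inv]
  exact tp3.inv_left

lemma triple_eq_one (g h : G) : ⁅⁅cj u g, cj u h⁆, u⁆ = 1 := by
  have h1 := hu.triple_jacobi hexp h3 hR g h
  have h2 := hu.triple_jacobi hexp h3 hR g (g * h)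
  have h3' := hu.triple_jacobi hexp h3 hR h (g * h)
  rw [hu.commutator_comm hexp, hu.triple_mul_left hexp h3 hR, hu.commutator_comm hexp, h1,
    mul_left_inj] at h2
  rw [hu.commutator_comm hexp, hu.triple_mul_right hexp h3 hR, ← h2] at h3'
  exact left_eq_mul.1 h3'

end IsTame

lemma commutator_closure_le {S T : Set G} {D : Subgroup G} [D.Normal]
    (h : ∀ s ∈ S, ∀ t ∈ T, ⁅s, t⁆ ∈ D) : ⁅Subgroup.closure S, Subgroup.closure T⁆ ≤ D := by
  have key : ⁅Subgroup.closure (QuotientGroup.mk' D '' S),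
      Subgroup.closure (QuotientGroup.mk' D '' T)⁆ = ⊥ := by
    rw [Subgroup.commutator_eq_bot_iff_le_centralizer, Subgroup.centralizer_closure,
      Subgroup.closure_le]
    rintro _ ⟨s, hs, rfl⟩
    rw [SetLike.mem_coe, Subgroup.mem_centralizer_iff_commutator_eq_one]
    rintro _ ⟨t, ht, rfl⟩
    rw [← map_commutatorElement, ← commutatorElement_inv, map_inv, inv_eq_one]
    exact (QuotientGroup.eq_one_iff _).2 (h s hs t ht)
  rw [← MonoidHom.map_closure, ← MonoidHom.map_closure, ← Subgroup.map_commutator,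
    Subgroup.map_eq_bot_iff, QuotientGroup.ker_mk'] at key
  exact key

/-- To bound the third term of the lower central series of the normal closure of `u`, it is enough
to consider commutators of conjugates. -/
lemma lowerCentral_normalClosure_le {M : Subgroup G} [M.Normal]
    (h : ∀ g h, ⁅⁅cj u g, cj u h⁆, u⁆ ∈ M) :
    ⁅⁅Subgroup.normalClosure {u}, Subgroup.normalClosure {u}⁆, Subgroup.normalClosure {u}⁆ ≤ M := by
  have h' : ∀ g h k, ⁅⁅cj u g, cj u h⁆, cj u k⁆ ∈ M := fun g h' k => by
    have := ‹M.Normal›.conj_mem _ (h (k⁻¹ * g) (k⁻¹ * h')) k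
    rwa [conj_commutator, conj_commutator_cj, mul_inv_cancel_left, mul_inv_cancel_left] at this
  let D : Subgroup G :=
    (Subgroup.centralizer (Set.range fun k => QuotientGroup.mk' M (cj u k))).comap
    (QuotientGroup.mk' M)
  have hmem : ∀ x, x ∈ D ↔ ∀ k, ⁅x, cj u k⁆ ∈ M := fun x => by
    rw [Subgroup.mem_comap, Subgroup.mem_centralizer_iff_commutator_eq_one, Set.forall_mem_range]
    refine forall_congr' fun k => ?_
    rw [← map_commutatorElement, ← commutatorElement_inv, map_inv, inv_eq_one]
    exact QuotientGroup.eq_one_iff _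
  have hD : D.Normal := ⟨fun x hx g => (hmem _).2 fun k => by
    have := ‹M.Normal›.conj_mem _ ((hmem x).1 hx (g⁻¹ * k)) g
    rwa [conj_commutator, conj_cj, mul_inv_cancel_left] at this⟩
  have h1 : ⁅Subgroup.normalClosure {u}, Subgroup.normalClosure {u}⁆ ≤ D := by
    rw [← closure_cj]
    refine commutator_closure_le ?_
    rintro _ ⟨g, rfl⟩ _ ⟨h, rfl⟩
    exact (hmem _).2 (h' g h)
  refine (Subgroup.commutator_mono h1 le_rfl).trans ?_
  rw [← Subgroup.closure_eq D, ← closure_cj]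
  refine commutator_closure_le ?_
  rintro x hx _ ⟨k, rfl⟩
  exact (hmem x).1 hx k

lemma isClassTwo_normalClosure (h : ∀ g h, ⁅⁅cj u g, cj u h⁆, u⁆ = 1) :
    IsClassTwo (Subgroup.normalClosure {u}) := by
  intro x y z
  have := lowerCentral_normalClosure_le (u := u) (M := ⊥) (fun g k => h g k)
  have h1 := this (Subgroup.commutator_mem_commutator (Subgroup.commutator_mem_commutator
    x.2 y.2) z.2)
  exact Subtype.ext (commutatorElement_eq_one_iff_mul_comm.1 h1)

lemma exponent_four_quotient (hexp : ∀ g : G, g ^ 4 = 1) (N : Subgroup G) [N.Normal] (g : G ⧸ N) :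
    g ^ 4 = 1 := by
  obtain ⟨g, rfl⟩ := QuotientGroup.mk_surjective g
  rw [← QuotientGroup.mk_pow, hexp, QuotientGroup.mk_one]

lemma cj_map {G' : Type*} [Group G'] (f : G →* G') (g : G) : f (cj u g) = cj (f u) (f g) := by
  simp [cj]

/-- If the normal closure of a tame element has class at most 3, it has class at most 2. -/
lemma IsTame.triple_eq_one_of_class_three (hexp : ∀ g : G, g ^ 4 = 1) (hu : IsTame u)
    {H : Subgroup G} (hH : H = Subgroup.normalClosure {u}) (h : ⁅⁅⁅H, H⁆, H⁆, H⁆ = ⊥) (g k : G) :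
    ⁅⁅cj u g, cj u k⁆, u⁆ = 1 := by
  have hm : ∀ g, cj u g ∈ H := fun g => hH ▸ cj_mem u g
  have hu' : u ∈ H := by simpa using hm 1
  have hn : H.Normal := hH ▸ Subgroup.normalClosure_normal
  have h4 : ∀ x ∈ ⁅⁅H, H⁆, H⁆, ∀ y ∈ H, Commute x y := fun x hx y hy =>
    commutatorElement_eq_one_iff_mul_comm.1
      (Subgroup.mem_bot.1 (h ▸ Subgroup.commutator_mem_commutator hx hy))
  refine hu.triple_eq_one hexp (fun g h k l => h4 _ (Subgroup.commutator_mem_commutator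
    (Subgroup.commutator_mem_commutator (hm g) (hm h)) (hm k)) _ (hm l)) (fun x a => ?_) g k
  refine h4 _ ?_ _ hu'
  rw [← QuotientGroup.eq_one_iff]
  have hc : IsClassTwo (Subgroup.normalClosure {QuotientGroup.mk' ⁅⁅H, H⁆, H⁆ u}) := by
    refine isClassTwo_normalClosure fun g k => ?_
    obtain ⟨g, rfl⟩ := QuotientGroup.mk'_surjective _ g
    obtain ⟨k, rfl⟩ := QuotientGroup.mk'_surjective _ k
    rw [← cj_map, ← cj_map, ← map_commutatorElement, ← map_commutatorElement]
    exact (QuotientGroup.eq_one_iff _).2 (Subgroup.commutator_mem_commutator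
    (Subgroup.commutator_mem_commutator (hm g) (hm k)) hu')
  have := (hu.map _ (QuotientGroup.mk'_surjective _)).interleave (exponent_four_quotient hexp _) hc
    (x : G ⧸ ⁅⁅H, H⁆, H⁆) a
  rw [← this]
  simp only [← QuotientGroup.mk'_apply, map_mul, map_commutatorElement, cj_map, map_pow]

lemma IsTame.triple_eq_one_of_finite [Finite G] (hexp : ∀ g : G, g ^ 4 = 1) (hu : IsTame u)
    (g k : G) : ⁅⁅cj u g, cj u k⁆, u⁆ = 1 := by
  have hp : IsPGroup 2 G := fun g => ⟨2, hexp g⟩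
  have hnil : Group.IsNilpotent G := hp.isNilpotent
  obtain ⟨n, hn⟩ := Subgroup.nilpotent_iff_lowerCentralSeries.1 hnil
  obtain ⟨H, hH⟩ : ∃ H, H = Subgroup.normalClosure {u} := ⟨_, rfl⟩
  have hm : ∀ g, cj u g ∈ H := fun g => hH ▸ cj_mem u g
  have hu' : u ∈ H := by simpa using hm 1
  have hN : H.Normal := hH ▸ Subgroup.normalClosure_normal
  have hle : ⁅⁅H, H⁆, H⁆ ≤ ⁅⁅⁅H, H⁆, H⁆, H⁆ := by
    have key : ∀ g h, ⁅⁅cj u g, cj u h⁆, u⁆ ∈ ⁅⁅⁅H, H⁆, H⁆, H⁆ := fun g k => by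
      have hs := QuotientGroup.mk'_surjective ⁅⁅⁅H, H⁆, H⁆, H⁆
      have e := congrArg (Subgroup.map (QuotientGroup.mk' ⁅⁅⁅H, H⁆, H⁆, H⁆)) hH
      rw [Subgroup.map_normalClosure _ _ hs, Set.image_singleton] at e
      have := (hu.map _ hs).triple_eq_one_of_class_three
        (exponent_four_quotient hexp ⁅⁅⁅H, H⁆, H⁆, H⁆) e (by
          rw [← Subgroup.map_commutator, ← Subgroup.map_commutator, ← Subgroup.map_commutator,
            Subgroup.map_eq_bot_iff, QuotientGroup.ker_mk']) g k
      rw [← QuotientGroup.eq_one_iff, ← this]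
      simp only [← QuotientGroup.mk'_apply, map_commutatorElement, cj_map]
    subst hH
    exact lowerCentral_normalClosure_le key
  have hall : ∀ n, ⁅⁅H, H⁆, H⁆ ≤ Subgroup.lowerCentralSeries ⊤ n := fun n => by
    induction n with
    | zero => exact le_top
    | succ n ih => exact hle.trans (Subgroup.commutator_mono ih le_top)
  exact Subgroup.mem_bot.1 (hn ▸ hall n (Subgroup.commutator_mem_commutator
    (Subgroup.commutator_mem_commutator (hm g) (hm k)) hu'))

end ClassThree

section

variable {G : Type*} [Group G] {u : G}

/-- In a group of exponent 4, the normal closure of a tame element is nilpotent of class at most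
2. -/
theorem IsTame.isClassTwo (hexp : ∀ g : G, g ^ 4 = 1) (hu : IsTame u) :
    IsClassTwo (Subgroup.normalClosure {u}) := by
  refine isClassTwo_normalClosure fun g k => ?_
  have hfin : Finite (Subgroup.closure {u, g, k}) :=
    finite_closure_of_exponent_four hexp (Set.toFinite _)
  have hmem : ∀ x ∈ ({u, g, k} : Set G), x ∈ Subgroup.closure {u, g, k} :=
    fun x hx => Subgroup.subset_closure hx
  have hu' : IsTame (⟨u, hmem u (by simp)⟩ : Subgroup.closure {u, g, k}) :=
    IsTame.of_injective (Subgroup.subtype _) Subtype.val_injective hu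
  exact congrArg Subtype.val (hu'.triple_eq_one_of_finite (fun x => Subtype.ext (hexp x))
    ⟨g, hmem g (by simp)⟩ ⟨k, hmem k (by simp)⟩)

end

/-- The identities satisfied by the commutators `⁅m * u * m⁻¹, n * u * n⁻¹⁆`, written additively. -/
structure IsConjPairing {G M : Type*} [Group G] [AddCommGroup M] [DistribMulAction G M]
    (Q : G → G → M) : Prop where
  two : ∀ m n, Q m n + Q m n = 0
  smul : ∀ k m n, k • Q m n = Q (k * m) (k * n)
  comm : ∀ m n, Q m n = Q n m
  smul_self : ∀ g, g • Q 1 g = Q 1 g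
  sq : ∀ x, Q 1 (x ^ 2) = 0
  block : ∀ m c h, Q m h + Q m (c * h) + Q m (c ^ 2 * h) + Q m (c ^ 3 * h) = 0
  rel : ∀ g h, Q 1 g + h • Q 1 g = Q 1 (h * g) + h⁻¹ • Q 1 (h⁻¹ * g)

/-- The identities that hold for an element `v` whose square centralizes all conjugates of `u`, and
which centralizes the squares of all conjugates of `u`. -/
structure IsConjPairing.IsTrivialOn {G M : Type*} [Group G] [AddCommGroup M] [DistribMulAction G M]
    (Q : G → G → M) (v : G) : Prop where
  conj : ∀ k, Q 1 (k * v * k⁻¹) = 0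
  mul_sq_mul : ∀ g h, Q 1 (g * v ^ 2 * h) = Q 1 (g * h)
  smul_smul : ∀ g, v • v • Q 1 g = Q 1 g

namespace IsConjPairing

variable {G M : Type*} [Group G] [AddCommGroup M] [DistribMulAction G M] {Q : G → G → M} {v : G}

section Basic

variable (hQ : IsConjPairing Q)
include hQ

lemma eq_smul (m n : G) : Q m n = m • Q 1 (m⁻¹ * n) := by
  rw [hQ.smul, mul_one, mul_inv_cancel_left]

lemma eq_of_add_eq_zero {k l m n : G} (h : Q k l + Q m n = 0) : Q k l = Q m n := by
  have := hQ.two m n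
  grind

lemma inv_smul_self (g : G) : g⁻¹ • Q 1 g = Q 1 g := by
  rw [inv_smul_eq_iff, hQ.smul_self]

lemma inv (g : G) : Q 1 g⁻¹ = Q 1 g := by
  rw [← hQ.inv_smul_self g, hQ.smul, mul_one, inv_mul_cancel, hQ.comm]

lemma opposite (c h : G) : Q h (c ^ 2 * h) = 0 := by
  have : h⁻¹ * (c ^ 2 * h) = (h⁻¹ * c * h) ^ 2 := by rw [pow_two, pow_two]; group
  rw [hQ.eq_smul, this, hQ.sq, smul_zero]

lemma self (h : G) : Q h h = 0 := by
  simpa using hQ.opposite 1 h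

lemma consecutive (c h : G) : Q (c * h) (c ^ 2 * h) = Q h (c * h) := by
  have := hQ.block (c * h) c h
  have h1 := hQ.self (c * h)
  have h2 := hQ.opposite c (c * h)
  rw [← mul_assoc, ← pow_succ] at h2
  rw [h1, h2, add_zero, add_zero] at this
  rw [hQ.comm h]
  exact (hQ.eq_of_add_eq_zero this).symm

end Basic

section Trivial

variable (hexp : ∀ g : G, g ^ 4 = 1) (hQ : IsConjPairing Q) (hv : IsTrivialOn Q v)

include hv in
lemma inv_smul (g : G) : v⁻¹ • Q 1 g = v • Q 1 g := by
  rw [inv_smul_eq_iff, hv.smul_smul]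

include hv in
lemma mul_inv_mul (g h : G) : Q 1 (g * v⁻¹ * h) = Q 1 (g * v * h) := by
  rw [← hv.mul_sq_mul]
  congr 1
  group

include hQ hv in
lemma conj_inv (k : G) : Q 1 (k * v⁻¹ * k⁻¹) = 0 := by
  rw [← hv.conj k, ← hQ.inv]
  congr 1
  group

include hQ hv in
lemma add_smul_eq_sq (a : G) : Q 1 a + v • Q 1 a = Q 1 (v * a ^ 2) := by
  have h := hQ.rel a (v * a)
  rw [mul_smul, hQ.smul_self] at h
  have h2 := hQ.conj_inv hv a⁻¹
  rw [inv_inv] at h2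
  rwa [mul_inv_rev, h2, smul_zero, add_zero, mul_assoc, ← pow_two] at h

include hexp hQ hv in
lemma sq_mul (a : G) : Q 1 (a ^ 2 * v) = Q 1 a + v • Q 1 a := by
  have h2 : (a ^ 2)⁻¹ = a ^ 2 := inv_eq_of_mul_eq_one_left (by rw [← pow_add]; exact hexp a)
  have := mul_inv_mul hv 1 (a ^ 2)
  rw [hQ.add_smul_eq_sq hv, ← hQ.inv, mul_inv_rev, h2]
  simpa using this

include hQ hv in
lemma add_smul_eq_mul (a : G) : Q 1 a + v • Q 1 a = Q 1 (a * v) + v • Q 1 (a * v) := by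
  have h := hQ.rel a⁻¹ v
  have h1 := mul_inv_mul hv a 1
  rw [mul_one, mul_one] at h1
  have h2 := hQ.inv (a * v⁻¹)
  rw [mul_inv_rev, inv_inv] at h2
  rwa [inv_smul hv, ← mul_inv_rev, hQ.inv, hQ.inv, h2, h1] at h

include hexp hQ hv in
lemma smul_add_smul (a : G) : a • (Q 1 a + v • Q 1 a) = Q 1 a + v • Q 1 a := by
  have h := hQ.rel (a * v) a⁻¹
  have h0 : Q 1 v = 0 := by simpa using hv.conj 1
  have h1 : v • Q 1 (a * v) = a⁻¹ • Q 1 (a * v) := by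
    rw [eq_inv_smul_iff, ← mul_smul, hQ.smul_self]
  rw [inv_inv, inv_mul_cancel_left, h0, zero_add, ← h1, ← hQ.add_smul_eq_mul hv, ← mul_assoc,
    ← pow_two,
    hQ.sq_mul hexp hv] at h
  exact h.symm

include hv in
lemma smul_add_smul' (a : G) : v • (Q 1 a + v • Q 1 a) = Q 1 a + v • Q 1 a := by
  rw [smul_add, hv.smul_smul, add_comm]

end Trivial

section Involution

variable (hexp : ∀ g : G, g ^ 4 = 1) (hQ : IsConjPairing Q) (hv : IsTrivialOn Q v)
  (hv2 : v * v = 1)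

include hQ hv hv2 in
lemma mul_mul_self (a : G) : Q 1 (a * v * a) = Q 1 a + v • Q 1 a := by
  have hvi : v⁻¹ = v := inv_eq_of_mul_eq_one_left hv2
  have h := hQ.rel (v * a) a
  have h1 : a • Q 1 (v * a) = v • Q 1 (v * a) := by
    rw [← inv_smul hv, eq_inv_smul_iff, ← mul_smul, hQ.smul_self]
  have h2 := hv.conj a⁻¹
  rw [inv_inv, mul_assoc] at h2
  have h3 := hQ.rel a v
  rw [h1, h2, smul_zero, add_zero, ← mul_assoc] at h
  rw [hvi] at h3
  rw [← h, h3]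

include hQ hv in
lemma smul_mul (a : G) : a • Q 1 (v * a) = v • Q 1 (v * a) := by
  rw [← inv_smul hv, eq_inv_smul_iff, ← mul_smul, hQ.smul_self]

include hQ hv2 in
lemma smul_mul' (a : G) : v • Q 1 (v * a) = Q 1 (v * a) + (Q 1 a + v • Q 1 a) := by
  have hvi : v⁻¹ = v := inv_eq_of_mul_eq_one_left hv2
  have h3 := hQ.rel a v
  have h4 := hQ.two 1 (v * a)
  rw [hvi] at h3
  rw [h3, ← add_assoc, h4, zero_add]

include hexp hQ hv hv2 in
lemma sq_mul_mul (a : G) : Q 1 (a ^ 2 * v * a) = a⁻¹ • Q 1 (v * a) := by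
  have h := hQ.rel (a * v * a) a
  rw [hQ.mul_mul_self hv hv2, hQ.smul_add_smul hexp hv, ← mul_assoc, ← mul_assoc,
    ← pow_two, ← mul_assoc, ← mul_assoc, inv_mul_cancel, one_mul] at h
  have h1 := hQ.two 1 a
  have h2 := congrArg (v • ·) h1
  have h3 := congrArg (a⁻¹ • ·) (hQ.two 1 (v * a))
  simp only [smul_add, smul_zero] at h2 h3
  grind

include hexp hQ hv hv2 in
lemma mul_sq_mul_mul (a : G) : Q 1 (v * a ^ 2 * v * a) = Q 1 a := by
  have hvi : v⁻¹ = v := inv_eq_of_mul_eq_one_left hv2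
  have h2i : (a ^ 2)⁻¹ = a ^ 2 := inv_eq_of_mul_eq_one_left (by rw [← pow_add]; exact hexp a)
  have h := hQ.rel (v * a) (v * a ^ 2)
  have e1 : (v * a ^ 2)⁻¹ * (v * a) = a⁻¹ := by rw [pow_two]; group
  have h1 := hQ.smul_mul hv a
  have h2 := hQ.smul_mul' hv2 a
  have h3 := hQ.smul_add_smul hexp hv a
  have h4 : a ^ 2 • Q 1 (v * a) = Q 1 (v * a) := by
    rw [pow_two, mul_smul, h1, h2, smul_add, h3, h1, h2]
    have := hQ.two 1 a
    have := congrArg (v • ·) this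
    simp only [smul_add, smul_zero] at this
    grind
  have h5 : a ^ 2 • v • Q 1 a = v • Q 1 a := by
    rw [smul_add] at h3
    have : a • v • Q 1 a = v • Q 1 a := by
      rw [hQ.smul_self] at h3; exact add_left_cancel h3
    rw [pow_two, mul_smul, this, this]
  rw [e1, hQ.inv, mul_inv_rev, h2i, hvi, mul_smul, mul_smul, h4, h5, h2, ← mul_assoc] at h
  have := hQ.two 1 (v * a)
  grind

include hexp hQ hv hv2 in
lemma inv_mul_mul_mul (a : G) : Q 1 (a⁻¹ * v * a * v * a) = v • Q 1 a := by
  have hvi : v⁻¹ = v := inv_eq_of_mul_eq_one_left hv2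
  have h := hQ.rel (a * v * a) (a⁻¹ * v)
  have e1 : (a⁻¹ * v)⁻¹ * (a * v * a) = v * a ^ 2 * v * a := by
    rw [mul_inv_rev, inv_inv, hvi, pow_two]; simp only [mul_assoc]
  have h3 := hQ.smul_add_smul hexp hv a
  have h4 : a⁻¹ • v • (Q 1 a + v • Q 1 a) = Q 1 a + v • Q 1 a := by
    rw [smul_add_smul' hv, inv_smul_eq_iff, h3]
  rw [hQ.mul_mul_self hv hv2, mul_smul, h4, e1, hQ.mul_sq_mul_mul hexp hv hv2, mul_inv_rev, inv_inv,
    hvi, mul_smul, hQ.smul_self] at h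
  have h5 := congrArg (v • ·) (hQ.two 1 a)
  have := hQ.two 1 a
  simp only [smul_add, smul_zero] at h5
  simp only [mul_assoc] at h ⊢
  grind

include hQ hv2 in
lemma add_eq_add (k n : G) : Q k n + Q (v * k) (v * n) = Q k (v * n) + Q (v * k) n := by
  have hvi : v⁻¹ = v := inv_eq_of_mul_eq_one_left hv2
  have h := congrArg (k • ·) (hQ.rel (k⁻¹ * n) (k⁻¹ * v * k))
  have e1 : (k⁻¹ * v * k)⁻¹ = k⁻¹ * v * k := by
    rw [mul_inv_rev, mul_inv_rev, inv_inv, hvi, mul_assoc]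
  simp only [smul_add, hQ.smul, e1, ← mul_assoc, mul_one, mul_inv_cancel, one_mul,
    mul_inv_cancel_right] at h
  rwa [hv2, one_mul] at h

include hexp hQ hv hv2 in
lemma conj_expansion (a : G) :
    Q a (a * v * a ^ 2) + Q a (a * v * a ^ 2 * v * a ^ 2) + Q a (v * a * v * a) + Q a (a ^ 2) +
      Q a (a * v * a ^ 2) + Q a (v * a⁻¹ * v * a) + Q a (v * a * v * a) +
      Q (v * a⁻¹ * v * a) (v * a * v * a) +
      (Q (a * v * a ^ 2 * v * a ^ 2) (a * v * a ^ 2) + Q (v * a * v * a) (a * v * a ^ 2) +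
      Q (a ^ 2) (a * v * a ^ 2)) + Q (a ^ 2) (v * a * v * a) = Q 1 a + v • Q 1 a := by
  have hvi : v⁻¹ = v := inv_eq_of_mul_eq_one_left hv2
  have h4 : ∀ x : G, x⁻¹ = x ^ 3 := fun x => inv_eq_of_mul_eq_one_left (by rw [← pow_succ, hexp])
  have hvv : ∀ x, v * (v * x) = x := fun x => by rw [← mul_assoc, hv2, one_mul]
  have w1 : (a * v) ^ 2 * a ^ 2 = v * a⁻¹ * v * a := by
    calc (a * v) ^ 2 * a ^ 2 = ((a * v) ^ 2)⁻¹ * (a * v) ^ 4 * a ^ 2 := by group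
      _ = v⁻¹ * a⁻¹ * v⁻¹ * a := by rw [hexp, pow_two, pow_two]; group
      _ = _ := by rw [hvi]
  have w2 : (a * v) ^ 3 * a ^ 2 = v * a := by
    rw [← h4, mul_inv_rev, hvi, pow_two]; group
  have w3 : (v * a * v) ^ 2 = v * a ^ 2 * v := by
    rw [pow_two, pow_two]; simp only [mul_assoc, hvv]
  -- the positions of the letters in their blocks
  have tm : Q (v * a * v * a) (v * a⁻¹ * v * a) = 0 := by
    have := hQ.opposite (v * a * v) (v * a * v * a)
    rwa [w3, show v * a ^ 2 * v * (v * a * v * a) = v * a ^ 3 * v * a by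
      rw [pow_succ a 2]; simp only [mul_assoc, hvv], ← h4] at this
  have ag : Q a (a * v * a ^ 2 * v * a ^ 2) = 0 := by
    have := hQ.opposite (a * v * a) a
    rwa [show (a * v * a) ^ 2 * a = a * v * a ^ 2 * v * a ^ 2 by simp only [pow_two]; group] at this
  have ab : Q (a * v * a ^ 2 * v * a ^ 2) (a * v * a ^ 2) = Q 1 a + v • Q 1 a := by
    have h := hQ.consecutive (a * v * a) a
    have e1 : a * v * a * a = a * (v * a ^ 2) := by rw [pow_two]; group
    have e2 : (a * v * a) ^ 2 * a = a * v * a ^ 2 * v * a ^ 2 := by simp only [pow_two]; group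
    have h' := hQ.smul a 1 (v * a ^ 2)
    rw [mul_one, ← hQ.add_smul_eq_sq hv, hQ.smul_add_smul hexp hv] at h'
    rwa [e1, e2, ← h', ← mul_assoc, hQ.comm] at h
  have bl : Q (v * a * v * a) (a ^ 2) + Q (v * a * v * a) (a * v * a ^ 2) + Q 1 (v * a) = 0 := by
    have h := hQ.block (v * a * v * a) (a * v) (a ^ 2)
    have h' := hQ.consecutive (v * a) 1
    have e1 : (v * a) ^ 2 = v * a * v * a := by rw [pow_two]; group
    rw [mul_one, mul_one, e1] at h'
    rwa [w1, w2, tm, add_zero, hQ.comm _ (v * a), h'] at h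
  have ad : Q a (a ^ 2) = Q 1 a := by simpa using hQ.consecutive a 1
  have db : Q (a ^ 2) (a * v * a ^ 2) = Q (v * a) (v * a⁻¹ * v * a) := by
    have h := hQ.consecutive (a * v) (a ^ 2)
    have h' := hQ.consecutive (a * v) (a * v * a ^ 2)
    have e1 : a * v * (a * v * a ^ 2) = v * a⁻¹ * v * a := by rw [← w1, pow_two (a * v)]; group
    have e2 : (a * v) ^ 2 * (a * v * a ^ 2) = v * a := by rw [← w2]; simp only [pow_succ]; group
    rw [e1, e2] at h'
    rw [w1] at h
    rw [← h, ← h', hQ.comm]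
  have key := hQ.add_eq_add hv2 a (a⁻¹ * v * a)
  have k1 : Q a (a⁻¹ * v * a) = Q 1 (v * a) := by
    have h2i : (a ^ 2)⁻¹ = a ^ 2 := inv_eq_of_mul_eq_one_left (by rw [← pow_add]; exact hexp a)
    rw [hQ.eq_smul, show a⁻¹ * (a⁻¹ * v * a) = (a ^ 2)⁻¹ * v * a by rw [pow_two]; group, h2i,
      hQ.sq_mul_mul hexp hv hv2, smul_inv_smul]
  have k2 : Q (v * a) (a⁻¹ * v * a) = Q 1 a := by
    have h3 := hQ.smul_add_smul hexp hv a
    rw [smul_add, hQ.smul_self] at h3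
    rw [hQ.comm, hQ.eq_smul, show (a⁻¹ * v * a)⁻¹ * (v * a) = a⁻¹ * v⁻¹ * a * v * a by group, hvi,
      hQ.inv_mul_mul_mul hexp hv hv2, mul_smul, mul_smul, add_left_cancel h3, hv.smul_smul,
      hQ.inv_smul_self]
  rw [k1, k2, ← mul_assoc, ← mul_assoc] at key
  rw [ad, ab, db, hQ.comm (a ^ 2), ag, hQ.comm (v * a⁻¹ * v * a), tm]
  have := hQ.two a (a * v * a ^ 2)
  have := hQ.two a (v * a * v * a)
  have := hQ.two 1 a
  have := hQ.two 1 (v * a)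
  have := hQ.two (v * a * v * a) (a ^ 2)
  have := hQ.two (v * a * v * a) (a * v * a ^ 2)
  have := hQ.two a (v * a⁻¹ * v * a)
  have := hQ.two (v * a) (v * a⁻¹ * v * a)
  grind

end Involution

end IsConjPairing

section Pairing

variable {G : Type*} [Group G] {u v : G}

/-- The central elements of the normal closure of `u` whose square is trivial. -/
def centralInvolutions (u : G) : Subgroup G where
  carrier := {x | x ∈ Subgroup.normalClosure {u} ∧
    (∀ y ∈ Subgroup.normalClosure {u}, Commute x y) ∧ x * x = 1}
  one_mem' := ⟨one_mem _, fun y _ => Commute.one_left y, one_mul 1⟩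
  mul_mem' := by
    rintro x y ⟨hx, hx', hxx⟩ ⟨hy, hy', hyy⟩
    refine ⟨mul_mem hx hy, fun z hz => (hx' z hz).mul_left (hy' z hz), ?_⟩
    rw [(hx' y hy).symm.mul_mul_mul_comm, hxx, hyy, one_mul]
  inv_mem' := by
    rintro x ⟨hx, hx', hxx⟩
    exact ⟨inv_mem hx, fun z hz => (hx' z hz).inv_left, by rw [← mul_inv_rev, hxx, inv_one]⟩

instance : CommGroup (centralInvolutions u) :=
  { (centralInvolutions u).toGroup with
    mul_comm := fun x y => Subtype.ext (x.2.2.1 y y.2.1) }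

lemma conj_mem_centralInvolutions (g : G) {x : G} (hx : x ∈ centralInvolutions u) :
    g * x * g⁻¹ ∈ centralInvolutions u := by
  obtain ⟨h1, h2, h3⟩ := hx
  refine ⟨Subgroup.normalClosure_normal.conj_mem _ h1 g, fun y hy => ?_, ?_⟩
  · have := (h2 _ (Subgroup.normalClosure_normal.conj_mem _ hy g⁻¹)).conj g
    convert this using 1
    group
  · rw [← pow_two, conj_pow, pow_two, h3, mul_one, mul_inv_cancel]

instance : DistribMulAction G (Additive (centralInvolutions u)) where
  smul g x := .ofMul ⟨g * (x.toMul : G) * g⁻¹, conj_mem_centralInvolutions g x.toMul.2⟩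
  one_smul x := congrArg Additive.ofMul
    (Subtype.ext (show 1 * (x.toMul : G) * 1⁻¹ = _ by simp; rfl))
  mul_smul g h x := congrArg Additive.ofMul
    (Subtype.ext (show _ = g * (h * _ * h⁻¹) * g⁻¹ by group))
  smul_zero g := congrArg Additive.ofMul (Subtype.ext (by simp))
  smul_add g x y := congrArg Additive.ofMul
    (Subtype.ext (show _ = (g * (x.toMul : G) * g⁻¹) * (g * y.toMul * g⁻¹) by simp))

lemma centralInvolutions_ext {x y : Additive (centralInvolutions u)}
    (h : (x.toMul : G) = y.toMul) : x = y := Subtype.ext h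

lemma coe_toMul_add (x y : Additive (centralInvolutions u)) :
    ((x + y).toMul : G) = x.toMul * y.toMul := rfl

lemma coe_toMul_zero : ((0 : Additive (centralInvolutions u)).toMul : G) = 1 := rfl

lemma coe_toMul_smul (g : G) (x : Additive (centralInvolutions u)) :
    ((g • x).toMul : G) = g * x.toMul * g⁻¹ := rfl

namespace IsTame

variable (hexp : ∀ g : G, g ^ 4 = 1) (hu : IsTame u)

include hexp hu in
lemma commutator_mem (m n : G) : ⁅cj u m, cj u n⁆ ∈ centralInvolutions u :=
  ⟨(⁅cjN u m, cjN u n⁆ : Subgroup.normalClosure {u}).2,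
    fun y hy => (congrArg Subtype.val (hu.isClassTwo hexp (cjN u m) (cjN u n) ⟨y, hy⟩).eq :),
    by rw [← pow_two, hu.commutator_sq hexp]⟩

/-- The commutator `⁅m * u * m⁻¹, n * u * n⁻¹⁆` as an element of an additive group. -/
def pairing (m n : G) : Additive (centralInvolutions u) :=
  .ofMul ⟨⁅cj u m, cj u n⁆, hu.commutator_mem hexp m n⟩

lemma coe_pairing (m n : G) : ((hu.pairing hexp m n).toMul : G) = ⁅cj u m, cj u n⁆ := rfl

include hexp hu in
lemma commutator_cjN_inv (m n : G) : ⁅cjN u m, cjN u n⁆⁻¹ = ⁅cjN u m, cjN u n⁆ :=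
  Subtype.ext (hu.commutator_inv hexp m n)

include hexp in
lemma cjN_block (c h : G) : cjN u h * cjN u (c * h) * cjN u (c ^ 2 * h) * cjN u (c ^ 3 * h) = 1 :=
  Subtype.ext (cj_block hexp c h)

lemma isConjPairing : IsConjPairing (hu.pairing hexp) where
  two m n := by
    exact centralInvolutions_ext (hu.pairing hexp m n).toMul.2.2.2
  smul k m n := centralInvolutions_ext (conj_commutator_cj k m n)
  comm m n := centralInvolutions_ext (hu.commutator_comm hexp m n)
  smul_self g := by
    refine centralInvolutions_ext ?_
    rw [coe_toMul_smul, coe_pairing, cj_one]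
    exact hu.conj_q hexp g
  sq x := by
    refine centralInvolutions_ext ?_
    rw [coe_pairing, cj_one, coe_toMul_zero]
    exact commutatorElement_eq_one_iff_commute.2 (hu.commute_cj_sq hexp x)
  block m c h := by
    have h2 := hu.isClassTwo hexp
    have := congrArg (⁅cjN u m, ·⁆) (cjN_block (u := u) hexp c h)
    simp only [h2.commutator_mul_right, commutatorElement_one_right] at this
    exact centralInvolutions_ext (congrArg Subtype.val this :)
  rel g h := by
    have h3 : h⁻¹ = h ^ 3 := inv_eq_of_mul_eq_one_left (by rw [← pow_succ, hexp])
    have h2 : h⁻¹ * (h⁻¹ * g) = h ^ 2 * g := by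
      calc h⁻¹ * (h⁻¹ * g) = (h ^ 4)⁻¹ * h ^ 2 * g := by group
        _ = h ^ 2 * g := by rw [hexp]; group
    have key : hu.pairing hexp g 1 + hu.pairing hexp (h * g) 1 + hu.pairing hexp (h * g) h +
        hu.pairing hexp (h ^ 2 * g) (h ^ 3) = 0 := by
      refine centralInvolutions_ext ?_
      simp only [coe_toMul_add, coe_pairing, coe_toMul_zero, cj_one]
      exact hu.interleave hexp (hu.isClassTwo hexp) h g
    have h1 : ∀ k m n, k • hu.pairing hexp m n = hu.pairing hexp (k * m) (k * n) := fun k m n =>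
      centralInvolutions_ext (conj_commutator_cj k m n)
    have h4 : ∀ m n, hu.pairing hexp m n = hu.pairing hexp n m := fun m n =>
      centralInvolutions_ext (hu.commutator_comm hexp m n)
    have h5 : ∀ m n, hu.pairing hexp m n + hu.pairing hexp m n = 0 := fun m n =>
      centralInvolutions_ext (hu.pairing hexp m n).toMul.2.2.2
    rw [h1, h1, h2, h3, mul_one, mul_one]
    rw [h4 g, h4 (h * g), h4 (h * g), h4 (h ^ 2 * g)] at key
    have := h5 1 (h * g)
    have := h5 (h ^ 3) (h ^ 2 * g)
    grind

end IsTame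

/-- The condition that makes `v` behave like an involution with respect to conjugates of `u`. -/
lemma IsTame.isTrivialOn (hexp : ∀ g : G, g ^ 4 = 1) (hu : IsTame u)
    (h1 : ∀ g, Commute (v ^ 2) (cj u g)) (h2 : ∀ g, Commute v (cj u g ^ 2)) :
    IsConjPairing.IsTrivialOn (hu.pairing hexp) v where
  conj k := by
    refine centralInvolutions_ext ?_
    rw [coe_pairing, cj_one, coe_toMul_zero]
    refine commutatorElement_eq_one_iff_commute.2 ?_
    have key : Commute (cj u k⁻¹) (cj u (v * k⁻¹)) := by
      have e1 := conj_cj (u := u) v k⁻¹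
      have e2 := (h2 k⁻¹).eq
      have e3 := (h1 k⁻¹).eq
      have e4 := hexp (cj u k⁻¹ * v)
      have e5 := hexp (cj u k⁻¹)
      rw [← e1]
      clear e1
      generalize cj u k⁻¹ = p at *
      have e6 : p * (v * p * v⁻¹) * (p * (v * p * v⁻¹)) = 1 :=
        calc _ = p * v * p * v⁻¹ * p * v * p * v⁻¹ * v ^ 4 := by rw [hexp]; group
          _ = p * v * p * v⁻¹ * p * v * (p * v ^ 2) * v := by group
          _ = p * v * p * v⁻¹ * p * v ^ 2 * (v * p * v) := by rw [← e3]; group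
          _ = p * v * p * v⁻¹ * (p * v ^ 2) * (v * p * v) := by group
          _ = (p * v) ^ 4 := by rw [← e3]; simp only [pow_succ, pow_zero]; group
          _ = 1 := e4
      calc p * (v * p * v⁻¹) = (p * (v * p * v⁻¹))⁻¹ := eq_inv_of_mul_eq_one_left e6
        _ = v * p * (v⁻¹ * (v * p ^ 2))⁻¹ * v⁻¹ * (p ^ 2)⁻¹ * p := by group
        _ = v * p * v⁻¹ * (v * p ^ 2 * v⁻¹)⁻¹ * (p ^ 2)⁻¹ * p := by group
        _ = v * p * v⁻¹ * (p ^ 4)⁻¹ * p := by rw [e2]; group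
        _ = v * p * v⁻¹ * p := by rw [e5]; group
    have := key.conj k
    convert this using 1 <;> simp only [cj] <;> group
  mul_sq_mul g h := by
    have : cj u (g * v ^ 2 * h) = cj u (g * h) := by
      rw [mul_assoc, ← conj_cj, ← conj_cj, ← conj_cj, (h1 h).eq, mul_inv_cancel_right]
    refine centralInvolutions_ext ?_
    rw [coe_pairing, coe_pairing, this]
  smul_smul g := by
    rw [← mul_smul]
    refine centralInvolutions_ext ?_
    rw [coe_toMul_smul, coe_pairing, conj_commutator, ← pow_two, (h1 _).eq, (h1 _).eq,
      mul_inv_cancel_right,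
      mul_inv_cancel_right]

end Pairing

section Expansion

lemma IsClassTwo.expansion {K : Type*} [Group K] (hK : IsClassTwo K) {α β γ δ μ t : K}
    (h₁ : t * t * (δ * δ) = 1) (h₂ : β * β * (γ * γ) = 1) :
    α * β * γ * t * δ * β * μ * (t * α⁻¹ * μ⁻¹ * δ * γ) =
      ⁅α, β * γ * t * δ * β * μ * t⁆ * ⁅μ, t⁆ * ⁅γ * t * δ, β⁆ * ⁅δ, t⁆ := by
  have s₁ := conj_eq_commutator_mul α (β * γ * t * δ * β * μ * t)
  have s₂ := conj_eq_commutator_mul μ t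
  have s₃ := conj_eq_commutator_mul (γ * t * δ) β
  have s₄ := conj_eq_commutator_mul δ t
  have c₂ := fun z => (hK μ t z).eq
  have c₃ := fun z => (hK (γ * t * δ) β z).eq
  have c₄ := fun z => (hK δ t z).eq
  generalize ⁅α, β * γ * t * δ * β * μ * t⁆ = d₁ at *
  generalize ⁅μ, t⁆ = d₂ at *
  generalize ⁅γ * t * δ, β⁆ = d₃ at *
  generalize ⁅δ, t⁆ = d₄ at *
  calc α * β * γ * t * δ * β * μ * (t * α⁻¹ * μ⁻¹ * δ * γ) =
        α * (β * γ * t * δ * β * μ * t) * α⁻¹ * μ⁻¹ * δ * γ := by group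
    _ = d₁ * β * γ * t * δ * β * (μ * t) * μ⁻¹ * δ * γ := by rw [s₁]; group
    _ = d₁ * (β * γ * t * δ * β * d₂) * t * δ * γ := by rw [s₂]; group
    _ = d₁ * d₂ * β * (γ * t * δ * β) * t * δ * γ := by rw [← c₂]; group
    _ = d₁ * d₂ * (β * d₃) * β * γ * t * (δ * t) * δ * γ := by rw [s₃]; group
    _ = d₁ * d₂ * d₃ * (β * β * γ * t * d₄) * t * δ * δ * γ := by rw [← c₃, s₄]; group
    _ = d₁ * d₂ * d₃ * d₄ * β * β * γ * (t * t * (δ * δ)) * γ := by rw [← c₄]; group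
    _ = d₁ * d₂ * d₃ * d₄ * (β * β * (γ * γ)) := by rw [h₁]; group
    _ = _ := by rw [h₂, mul_one]

end Expansion

section Main

variable {G : Type*} [Group G] {u v : G}

namespace IsTame

variable (hexp : ∀ g : G, g ^ 4 = 1) (hu : IsTame u)

lemma isTrivialOn_sq (x : G) : IsConjPairing.IsTrivialOn (hu.pairing hexp) (x ^ 2) := by
  refine hu.isTrivialOn hexp (fun g => ?_) fun g => ?_
  · rw [← pow_mul, hexp]
    exact Commute.one_left _
  · have := (hu.sq_sq (g⁻¹ * x * g)).conj g
    rw [cj_sq]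
    convert this.symm using 1
    simp only [pow_two]
    group

include hexp in
lemma commutator_conj_eq {v : G} (hv : IsTame v) (hv2 : v * v = 1) (a : G) :
    ⁅v, cj v a⁆ = a * v * a ^ 2 * v * a * v * a ^ 2 * v * a ^ 2 := by
  have hvi : v⁻¹ = v := inv_eq_of_mul_eq_one_left hv2
  have h1 := cj_block (u := v) hexp a 1
  simp only [mul_one, cj_one] at h1
  have h2 := conj_commutator_cj (u := v) a 1 a
  rw [cj_one, hv.conj_q hexp, mul_one, ← pow_two] at h2
  have i : ∀ g, (cj v g)⁻¹ = cj v g := fun g => by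
    simp only [cj, mul_inv_rev, inv_inv, hvi, mul_assoc]
  have h3 : cj v (a ^ 3) = cj v (a ^ 2) * cj v a * v := by
    calc cj v (a ^ 3) = (cj v (a ^ 2))⁻¹ * (cj v a)⁻¹ * v⁻¹ *
          (v * cj v a * cj v (a ^ 2) * cj v (a ^ 3)) := by group
      _ = _ := by rw [h1, i, i, hvi, mul_one]
  calc ⁅v, cj v a⁆ = cj v a * cj v (a ^ 2) * cj v a * (v * v) * cj v (a ^ 2) := by
        rw [h2, commutatorElement_def, i, i, hv2, mul_one]
    _ = cj v a * cj v (a ^ 3) * v * cj v (a ^ 2) := by rw [h3]; group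
    _ = a * v * a ^ 2 * v * (a ^ 4)⁻¹ * a * v * a ^ 2 * v * (a ^ 4)⁻¹ * a ^ 2 := by
      simp only [cj]; group
    _ = _ := by rw [hexp]; group

lemma commutator_commutator (a x : G) :
    ⁅u, ⁅x ^ 2, cj (x ^ 2) a⁆⁆ =
      ((hu.pairing hexp 1 a + x ^ 2 • hu.pairing hexp 1 a).toMul : G) := by
  have hK := hu.isClassTwo hexp
  have hQ := hu.isConjPairing hexp
  have hv2 : x ^ 2 * x ^ 2 = 1 := by rw [← pow_add]; exact hexp x
  have hS := fun g => hu.cj_sq_mul g x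
  have hv := hu.isTrivialOn_sq hexp x
  have hE := hQ.conj_expansion hexp hv hv2 a
  have hC := commutator_conj_eq hexp (.of_sq_eq_one (by rw [pow_two, hv2])) hv2 a
  have hvi : (x ^ 2)⁻¹ = x ^ 2 := inv_eq_of_mul_eq_one_left hv2
  generalize x ^ 2 = v at *
  have h4 : ∀ y : G, y⁻¹ = y ^ 3 := fun y => inv_eq_of_mul_eq_one_left (by rw [← pow_succ, hexp])
  have hvv : ∀ y, v * (v * y) = y := fun y => by rw [← mul_assoc, hv2, one_mul]
  have a4 : ∀ y, a * (a * (a * (a * y))) = y := fun y => by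
    have := hexp a
    rw [pow_succ, pow_succ, pow_two] at this
    rw [← mul_assoc, ← mul_assoc, ← mul_assoc, this, one_mul]
  have ai : a⁻¹ = a * (a * a) := by rw [h4, pow_succ, pow_two, mul_assoc]
  -- the blocks
  have B1 : cjN u 1 * cjN u (v * a) * cjN u (v * a * v * a) * cjN u (a⁻¹ * v) = 1 := by
    have := cjN_block (u := u) hexp (v * a) 1
    rwa [← h4, mul_inv_rev, hvi, pow_two, mul_one, mul_one, mul_one, ← mul_assoc] at this
  have B4 : cjN u a * cjN u (v * a * v * a) * cjN u (v * a ^ 2 * v * a) *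
      cjN u (v * a⁻¹ * v * a) = 1 := by
    have := cjN_block (u := u) hexp (v * a * v) a
    rw [← h4, mul_inv_rev, mul_inv_rev, hvi, pow_two] at this
    convert this using 3
    · simp only [pow_two, mul_assoc, hvv]
    · simp only [mul_assoc]
  have B5 : cjN u a * cjN u (a * v * a ^ 2) * cjN u (a * v * a ^ 2 * v * a ^ 2) *
      cjN u (a⁻¹ * v) = 1 := by
    have := cjN_block (u := u) hexp (a * v * a) a
    rw [← h4] at this
    convert this using 3
    · simp only [pow_two, mul_assoc]
    · simp only [pow_two, mul_assoc]
    · simp only [mul_inv_rev, hvi]; group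
  have B3 :
      cjN u (a ^ 2) * cjN u (a * v * a ^ 2) * cjN u (v * a⁻¹ * v * a) * cjN u (v * a) = 1 := by
    have := cjN_block (u := u) hexp (a * v) (a ^ 2)
    rw [← h4] at this
    convert this using 3
    · refine congrArg _ ?_
      calc v * a⁻¹ * v * a = (a * v) ^ 4 * (v⁻¹ * a⁻¹ * v⁻¹ * a) := by rw [hexp, one_mul, hvi]
        _ = (a * v) ^ 2 * a ^ 2 := by simp only [pow_succ, pow_zero]; group
    · simp only [mul_inv_rev, hvi, pow_two]; group
  have B2 : cjN u (a ^ 2) * cjN u (a * v * a ^ 2 * v * a ^ 2) *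
      cjN u (a * v * a ^ 2 * v * a * v * a ^ 2 * v * a ^ 2) * cjN u (v * a ^ 2 * v * a) = 1 := by
    have := cjN_block (u := u) hexp (a * v * a ^ 2 * v) (a ^ 2)
    rw [← h4] at this
    convert this using 3
    · simp only [pow_two, mul_assoc]
    · simp only [mul_inv_rev, hvi, pow_two, ai, mul_assoc, a4]
  have sq : ∀ m n, cj u m ^ 2 = cj u n ^ 2 →
      cjN u m * cjN u m = cjN u n * cjN u n := fun m n h => by
    simp only [pow_two] at h
    exact Subtype.ext h
  have S1 := sq (v * a * v * a) (a ^ 2) (by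
    have h1 := hu.cj_sq_mul 1 (v * a)
    have h2 := hu.cj_sq_mul 1 a
    rw [one_mul, pow_two (v * a), ← mul_assoc] at h1
    rw [h1, ← h2, one_mul])
  have S2 := sq (a * v * a ^ 2) a (by rw [hu.cj_sq_mul, hS])
  have S3 := sq (a * v * a ^ 2 * v * a ^ 2) a (by rw [hu.cj_sq_mul, hS, hu.cj_sq_mul, hS])
  have S4 : cjN u a * cjN u a * (cjN u a * cjN u a) = 1 := by
    have : cj u a ^ 4 = 1 := hexp _
    refine Subtype.ext (Eq.trans ?_ this)
    simp only [pow_succ, pow_zero, one_mul, mul_assoc]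
    rfl
  rw [hC, ← hE]
  have key := hK.expansion (α := cjN u a) (β := cjN u (a * v * a ^ 2))
    (γ := cjN u (a * v * a ^ 2 * v * a ^ 2)) (t := (cjN u (v * a * v * a))⁻¹)
    (δ := cjN u (a ^ 2)) (μ := cjN u (v * a⁻¹ * v * a))
    (by rw [← S1]; group) (by rw [S2, S3, S4])
  have e1 : cjN u 1 = cjN u a * cjN u (a * v * a ^ 2) * cjN u (a * v * a ^ 2 * v * a ^ 2) *
      (cjN u (v * a * v * a))⁻¹ * cjN u (a ^ 2) * cjN u (a * v * a ^ 2) *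
      cjN u (v * a⁻¹ * v * a) := by
    rw [eq_inv_of_mul_eq_one_left B5, mul_assoc _ (cjN u (a ^ 2)), mul_assoc _ (cjN u (a ^ 2) * _),
      eq_inv_of_mul_eq_one_left B3, ← mul_inv_rev, ← mul_inv_rev, eq_inv_iff_mul_eq_one, ← B1]
    group
  have e2 : (cjN u (a * v * a ^ 2 * v * a * v * a ^ 2 * v * a ^ 2))⁻¹ =
      (cjN u (v * a * v * a))⁻¹ * (cjN u a)⁻¹ * (cjN u (v * a⁻¹ * v * a))⁻¹ * cjN u (a ^ 2) *
      cjN u (a * v * a ^ 2 * v * a ^ 2) := by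
    have h : cjN u (v * a ^ 2 * v * a) = (cjN u (v * a * v * a))⁻¹ * (cjN u a)⁻¹ * 1 *
        (cjN u (v * a⁻¹ * v * a))⁻¹ := by rw [← B4]; group
    rw [mul_one] at h
    rw [← h]
    calc _ = cjN u (v * a ^ 2 * v * a) * 1⁻¹ * (cjN u (a ^ 2) *
          cjN u (a * v * a ^ 2 * v * a ^ 2)) := by rw [← B2]; group
      _ = _ := by group
  rw [← e1, ← e2] at key
  simp only [hK.commutator_mul_right, hK.commutator_mul_left, hK.commutator_inv_right,
    hK.commutator_inv_left, hu.commutator_cjN_inv hexp] at key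
  have := congrArg Subtype.val key
  refine Eq.trans ?_ this
  simp only [cjN, Subgroup.coe_mul, Subgroup.coe_inv, cj, commutatorElement_def]
  group

include hexp hu in
lemma commutator_mul_commutator {y w : G} (x a : G) (hy : x ^ 2 = y) (hw : a ^ 2 = w) :
    ⁅y, cj y (u * w)⁆ * ⁅w, cj w (u * y)⁆ = ⁅cj u w, cj u y⁆ := by
  have hyy : y * y = 1 := by rw [← hy, ← pow_add]; exact hexp x
  have hww : w * w = 1 := by rw [← hw, ← pow_add]; exact hexp a
  have hyi : y⁻¹ = y := inv_eq_of_mul_eq_one_left hyy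
  have hwi : w⁻¹ = w := inv_eq_of_mul_eq_one_left hww
  have hy' : ∀ g, y * (y * g) = g := fun g => by rw [← mul_assoc, hyy, one_mul]
  have hw' : ∀ g, w * (w * g) = g := fun g => by rw [← mul_assoc, hww, one_mul]
  have h3 : ∀ g : G, g⁻¹ = g ^ 3 := fun g => inv_eq_of_mul_eq_one_left (by rw [← pow_succ, hexp])
  have hp : w * y * w * y = y * w * y * w := by
    have := hexp (y * w)
    calc w * y * w * y = w⁻¹ * y⁻¹ * w⁻¹ * y⁻¹ * (y * w) ^ 4 := by rw [this, hyi, hwi, mul_one]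
      _ = y * w * y * w := by simp only [pow_succ, pow_zero]; group
  have hq : ∀ g k, Commute (cj u g) (cj u (g * k ^ 2)) := fun g k => by
    have := (hu.commute_cj_sq hexp k).conj g
    rwa [conj_cj] at this
  have eW : Commute u (cj u w) := by simpa [hw] using hq 1 a
  have eP : Commute u (cj u (y * w * y * w)) := by
    simpa [pow_two, mul_assoc] using hq 1 (y * w)
  have eY' : Commute u (cj u (y * w * y)) := by
    have := hq 1 (y * a * y⁻¹)
    rwa [conj_pow, hw, hyi, one_mul, cj_one] at this
  have PW : Commute (cj u w) (cj u (y * w * y * w)) := by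
    have := hq w (y * a * y⁻¹)
    rwa [conj_pow, hw, hyi, ← mul_assoc, ← mul_assoc, hp] at this
  have PW' : Commute (cj u (w * y * w)) (cj u (y * w * y * w)) := by
    have := hq (w * y * w) x
    rwa [hy, hp] at this
  have PP : cj u (y * w * y * w) ^ 2 = u ^ 2 := by
    have := hu.cj_sq_mul 1 (y * w)
    rwa [one_mul, cj_one, pow_two (y * w), ← mul_assoc] at this
  have eY'2 := hu.commute_sq_cj 1 (y * w * y)
  rw [cj_one] at eY'2
  have u4 := hexp u
  have hb : cj u w * cj u y * cj u (y * w * y) * cj u (w * y * w) = 1 := by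
    have := cj_block (u := u) hexp (y * w) w
    rwa [← h3, mul_inv_rev, hyi, hwi, pow_two, mul_assoc y w w, hww, mul_one, mul_assoc (y * w),
      mul_assoc y w w, hww, mul_one] at this
  have hQ := hu.isConjPairing hexp
  have hp' : ∀ g, w * (y * (w * (y * (w * g)))) = y * (w * (y * g)) := fun g => by
    have := congrArg (· * (w * g)) hp
    simpa only [mul_assoc, hw'] using this
  have h1 : ⁅y, cj y (u * w)⁆ = cj u y * (cj u (y * w * y * w))⁻¹ * cj u (w * y * w) * u⁻¹ := by
    simp only [commutatorElement_def, cj, mul_inv_rev, inv_inv, hyi, hwi, mul_assoc, hy', hw', hp']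
  have h2 : ⁅w, cj w (u * y)⁆ = cj u w * (cj u (y * w * y * w))⁻¹ * cj u (y * w * y) * u⁻¹ := by
    simp only [commutatorElement_def, cj, mul_inv_rev, inv_inv, hyi, hwi, mul_assoc, hy', hw', hp']
  have h4 : cj u y * cj u (w * y * w) * cj u w * cj u (y * w * y) = ⁅cj u w, cj u y⁆ := by
    have h5 := (hu.isClassTwo hexp).commutator_inv_right (cjN u y) (cjN u (y * w * y))
    rw [hu.commutator_cjN_inv hexp] at h5
    have h6 := congrArg (fun z => ((Additive.toMul z : centralInvolutions u) : G))
      (hQ.consecutive (y * w) w)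
    simp only [coe_pairing] at h6
    rw [mul_assoc y w w, hww, mul_one, pow_two, mul_assoc (y * w), mul_assoc y w w, hww,
      mul_one] at h6
    rw [← h6]
    refine Eq.trans ?_ (congrArg Subtype.val h5)
    have : cj u w = (cj u y * cj u (y * w * y) * cj u (w * y * w))⁻¹ :=
      eq_inv_of_mul_eq_one_left (by rw [← hb]; group)
    rw [this]
    simp only [cjN, Subgroup.coe_mul, Subgroup.coe_inv, commutatorElement_def]
    group
  rw [h1, h2, ← h4]
  clear h1 h2 h4 hb
  generalize cj u y = Y at *
  generalize cj u w = W at *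
  generalize cj u (y * w * y * w) = P at *
  generalize cj u (w * y * w) = W' at *
  generalize cj u (y * w * y) = Y' at *
  calc Y * P⁻¹ * W' * u⁻¹ * (W * P⁻¹ * Y' * u⁻¹) = Y * P⁻¹ * W' * (u⁻¹ * (W * P⁻¹ * Y')) * u⁻¹ := by
        group
    _ = Y * (P⁻¹ * (W' * W)) * P⁻¹ * Y' * u⁻¹ * u⁻¹ := by
      rw [((eW.mul_right eP.inv_right).mul_right eY').inv_left.eq]; group
    _ = Y * W' * W * (P ^ 2)⁻¹ * Y' * u⁻¹ * u⁻¹ := by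
      rw [← (PW'.mul_left PW).inv_right.eq]; group
    _ = Y * W' * W * ((u ^ 2)⁻¹ * Y') * u⁻¹ * u⁻¹ := by rw [PP]; group
    _ = Y * W' * W * Y' * (u ^ 4)⁻¹ := by rw [eY'2.inv_left.eq]; group
    _ = _ := by rw [u4]; group

lemma pairing_add_smul_eq_zero (a x : G) :
    hu.pairing hexp 1 a + x ^ 2 • hu.pairing hexp 1 a = 0 := by
  have key : ∀ a x : G, ⁅x ^ 2, cj (x ^ 2) (u * a ^ 2)⁆ = ⁅u, cj u (x ^ 2 * a ^ 2)⁆ := fun a x => by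
    have h1 := hu.commutator_commutator hexp a x
    rw [(hu.isConjPairing hexp).add_smul_eq_sq (hu.isTrivialOn_sq hexp x), coe_pairing,
      cj_one] at h1
    have hx : x ^ 2 * x ^ 2 = 1 := by rw [← pow_add]; exact hexp x
    have hy : IsTame (x ^ 2) := .of_sq_eq_one (by rw [pow_two, hx])
    have h2 := (hy.isConjPairing hexp).add_smul_eq_sq (v := u) (hy.isTrivialOn hexp
      (fun g => ?_) fun g => ?_) a
    · rw [add_comm] at h2
      have h3 := congrArg (fun z => ((Additive.toMul z : centralInvolutions (x ^ 2)) : G)) h2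
      simp only [coe_toMul_add, coe_toMul_smul, coe_pairing, cj_one] at h3
      have h4 := hy.commutator_inv hexp 1 a
      rw [cj_one] at h4
      rw [← h1, ← h3, commutatorElement_def u, h4]
    · have := hu.sq_sq (g * x * g⁻¹)
      rwa [conj_pow] at this
    · rw [cj_sq, pow_two (x ^ 2), hx, mul_one, mul_inv_cancel]
      exact Commute.one_right _
  have hQ := hu.isConjPairing hexp
  have h := hu.commutator_mul_commutator hexp x a rfl rfl
  rw [key, key] at h
  have h' : hu.pairing hexp 1 (x ^ 2 * a ^ 2) + hu.pairing hexp 1 (a ^ 2 * x ^ 2) =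
      hu.pairing hexp (a ^ 2) (x ^ 2) := by
    refine centralInvolutions_ext ?_
    simpa only [coe_toMul_add, coe_pairing, cj_one] using h
  have hi : ∀ g : G, (g ^ 2)⁻¹ = g ^ 2 := fun g =>
    inv_eq_of_mul_eq_one_left (by rw [← pow_add]; exact hexp g)
  have hs : hu.pairing hexp 1 (a ^ 2 * x ^ 2) = hu.pairing hexp 1 (x ^ 2 * a ^ 2) := by
    rw [← hQ.inv, mul_inv_rev, hi, hi]
  rw [hs, hQ.two, hQ.eq_smul, hi, hs, eq_comm, smul_eq_zero_iff_eq] at h'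
  rw [hQ.add_smul_eq_sq (hu.isTrivialOn_sq hexp x), h']

end IsTame

end Main

/-- Let `G` be a group of exponent 4 and `b ∈ G` such that `b² ∈ R₂(G)`. Then
`[a, b, b] ∈ R₂(G)` for every `a ∈ G`. -/
theorem stmt_1 {G : Type*} [Group G] (hexp : ∀ g : G, g ^ 4 = 1) (b : G)
    (hb : b ^ 2 ∈ R2 G) :
    ∀ a : G, lcomm (lcomm a b) b ∈ R2 G := by
  intro a x
  have hu : IsTame b := by
    refine isTame_of_sq_engel hexp fun y => ?_
    have h : lcomm (lcomm (b ^ 2) y) y = 1 := hb y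
    simp only [lcomm] at h ⊢
    generalize (b ^ 2)⁻¹ * y⁻¹ * b ^ 2 * y = c at *
    calc c * y = y * c * (c⁻¹ * y⁻¹ * c * y) := by group
      _ = y * c := by rw [h, mul_one]
  have hQ := hu.isConjPairing hexp
  have hc : lcomm (lcomm a b) b = ⁅b, cj b a⁻¹⁆ := by
    have h := (hu.commute_q_left hexp a⁻¹).eq
    calc lcomm (lcomm a b) b = b⁻¹ * (b⁻¹ * (⁅b, cj b a⁻¹⁆ * b)) * b := by
          simp only [lcomm, cj, commutatorElement_def]; group
      _ = ⁅b, cj b a⁻¹⁆ := by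
          rw [h, inv_mul_cancel_left, mul_assoc, h, inv_mul_cancel_left]
  have h0 := hu.pairing_add_smul_eq_zero hexp a⁻¹ x
  have h1 := congrArg (fun z => ((Additive.toMul z : centralInvolutions b) : G)) h0
  have h2 := congrArg (fun z => ((Additive.toMul z : centralInvolutions b) : G)) (hQ.two 1 a⁻¹)
  have h3 := congrArg (fun z => ((Additive.toMul z : centralInvolutions b) : G))
    (add_comm (hu.pairing hexp 1 a⁻¹) (x⁻¹ • hu.pairing hexp 1 a⁻¹))
  simp only [coe_toMul_add, coe_toMul_smul, IsTame.coe_pairing, cj_one, coe_toMul_zero, inv_inv,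
    ← hc] at h1 h2 h3
  generalize lcomm (lcomm a b) b = c at *
  have hci : c⁻¹ = c := inv_eq_of_mul_eq_one_left h2
  have h4 : x ^ 2 * c * (x ^ 2)⁻¹ = c := by
    rw [← inv_eq_of_mul_eq_one_right h1, hci]
  have h5 : x⁻¹ * (x⁻¹ * c * x) * x = c := by
    conv_lhs => rw [← h4]
    group
  have h6 : lcomm c x = c * (x⁻¹ * c * x) := by simp only [lcomm, hci, mul_assoc]
  rw [h6]
  calc lcomm (c * (x⁻¹ * c * x)) x
      = (c * (x⁻¹ * c * x))⁻¹ * ((x⁻¹ * c * x) * (x⁻¹ * (x⁻¹ * c * x) * x)) := by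
        simp only [lcomm]; group
    _ = 1 := by rw [h5, ← h3, inv_mul_cancel]
end

section
/- Let G be a group of exponent 4 (i.e., g^4 = 1 for all g in G) and let N be a normal subgroup of G whose underlying set equals R_2(G). Then every involution of the quotient group G/N is a left 2-Engel element of G/N; that is, for every u in G/N with u^2 = 1 and every x in G/N, [x, u, u] = 1. -/
universe u

/-! ### Local finiteness of groups of exponent four -/

section LocallyFinite

variable {G : Type*} [Group G] {H : Subgroup G}

/-- The product `t * h₁ * t * h₂ * ⋯ * t * hₙ * t`. -/
def alternating (t : G) : List H → G
  | [] => t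
  | h :: L => t * h * alternating t L

theorem alternating_append (t : G) (L : List H) (h : H) :
    alternating t (L ++ [h]) = alternating t L * h * t := by
  induction L with
  | nil => rfl
  | cons k L ih => simp only [List.cons_append, alternating, ih, mul_assoc]

/-- The elements that can be written as an element of `H`, or as an alternating product with fewer
than `n` inner factors multiplied by elements of `H` on both sides. -/
def IsShort (H : Subgroup G) (t : G) (n : ℕ) (g : G) : Prop :=
  g ∈ H ∨ ∃ (k : H) (L : List H) (k' : H), L.length < n ∧ g = k * alternating t L * k'

theorem IsShort.mul_mul {t g : G} {n : ℕ} (hg : IsShort H t n g) (a b : H) :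
    IsShort H t n (a * g * b) := by
  rcases hg with hg | ⟨k, L, k', hL, rfl⟩
  · exact Or.inl (mul_mem (mul_mem a.2 hg) b.2)
  · exact Or.inr ⟨a * k, L, k' * b, hL, by simp [mul_assoc]⟩

theorem isShort_or_exists_finset (hexp : ∀ g : G, g ^ 4 = 1) {t : G} (s : H) (hs : t * t = s)
    (L : List H) :
    IsShort H t L.length (alternating t L) ∨
      ∃ A : Finset H, L.length ≤ A.card ∧ 1 ∉ A ∧ ∀ a ∈ A, ∃ (L' : List H) (k : H),
        L'.length + 1 = L.length ∧ alternating t L = t * a * alternating t L' * k := by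
  classical
  have hinv : t⁻¹ = t * (s : G)⁻¹ := by rw [← hs]; group
  have hinv' : t⁻¹ = (s : G)⁻¹ * t := by rw [← hs]; group
  induction L with
  | nil => exact Or.inr ⟨∅, by simp⟩
  | cons h L ih =>
    rcases ih with (hL | ⟨k, L', k', hL', he⟩) | ⟨A, hA, hA1, hrep⟩
    · exact Or.inl (Or.inr ⟨1, [], h * ⟨_, hL⟩, by simp, by simp [alternating, mul_assoc]⟩)
    · exact Or.inl (Or.inr ⟨1, (h * k) :: L', k', by simpa using hL',
        by simp [alternating, he, mul_assoc]⟩)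
    by_cases hh1 : h = 1
    · left
      match L with
      | [] => exact Or.inl (by simp [alternating, hh1, hs])
      | c :: L =>
        refine Or.inr ⟨s * c, L, 1, by simp, ?_⟩
        simp [alternating, hh1, ← hs, mul_assoc]
    by_cases hhA : h ∈ A
    · obtain ⟨L', k, hL', he⟩ := hrep h hhA
      have h4 : t * h * (t * h) = (h : G)⁻¹ * (s : G)⁻¹ * t * ((h : G)⁻¹ * (s : G)⁻¹) * t := by
        have h5 : t * h * (t * h) = (t * h)⁻¹ * (t * h)⁻¹ := by
          rw [eq_comm, ← mul_inv_rev, inv_eq_iff_mul_eq_one]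
          simpa [pow_succ, mul_assoc] using hexp (t * h)
        rw [h5, mul_inv_rev, hinv']
        simp only [mul_assoc]
      have h6 : alternating t (h :: L) =
          (h : G)⁻¹ * (s : G)⁻¹ * t * ((h : G)⁻¹ * (s : G)⁻¹) * (t * alternating t L') * k := by
        rw [alternating, he]
        calc _ = t * h * (t * h) * alternating t L' * k := by simp only [mul_assoc]
          _ = _ := by rw [h4]; simp only [mul_assoc]
      left
      right
      match L' with
      | [] =>
        refine ⟨h⁻¹ * s⁻¹, [], h⁻¹ * k, by simp, ?_⟩
        rw [h6, alternating, hs]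
        simp [mul_assoc]
      | c :: L' =>
        refine ⟨h⁻¹ * s⁻¹, (h⁻¹ * c) :: L', k, ?_, ?_⟩
        · simp only [List.length_cons] at hL' ⊢
          omega
        · rw [h6, alternating, ← mul_assoc t (t * c), ← mul_assoc t t, hs]
          simp [alternating, mul_assoc]
    · right
      refine ⟨insert h (A.image fun a => h * a⁻¹), ?_, ?_, ?_⟩
      · rw [Finset.card_insert_of_notMem, Finset.card_image_of_injective]
        · simpa using hA
        · intro a b hab
          simpa using hab
        · simp only [Finset.mem_image, not_exists, not_and]
          intro a ha he
          exact hA1 (inv_eq_one.1 (mul_eq_left.1 he) ▸ ha)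
      · simp only [Finset.mem_insert, Finset.mem_image, not_or, not_exists, not_and]
        refine ⟨Ne.symm hh1, fun a ha he => hhA ?_⟩
        rwa [mul_inv_eq_one.1 he]
      · simp only [Finset.forall_mem_insert, Finset.forall_mem_image]
        refine ⟨⟨L, 1, rfl, by simp [alternating]⟩, fun a ha => ?_⟩
        obtain ⟨L', k, hL', he⟩ := hrep a ha
        have h4 : t * a =
            (a : G)⁻¹ * t * ((s : G)⁻¹ * (a : G)⁻¹ * (s : G)⁻¹) * t * (a : G)⁻¹ * t⁻¹ := by
          have h5 : t * a = (t * a)⁻¹ * (t * a)⁻¹ * (t * a)⁻¹ := by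
            rw [eq_comm, ← mul_inv_rev, ← mul_inv_rev, inv_eq_iff_mul_eq_one]
            simpa [pow_succ, mul_assoc] using hexp (t * a)
          calc t * a = (t * a)⁻¹ * (t * a)⁻¹ * (t * a)⁻¹ := h5
            _ = (a : G)⁻¹ * t⁻¹ * ((a : G)⁻¹ * t⁻¹) * ((a : G)⁻¹ * t⁻¹) := by
              simp only [mul_inv_rev]
            _ = (a : G)⁻¹ * (t * (s : G)⁻¹) * ((a : G)⁻¹ * ((s : G)⁻¹ * t)) *
                ((a : G)⁻¹ * t⁻¹) := by rw [← hinv, ← hinv']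
            _ = _ := by simp only [mul_assoc]
        have h6 : alternating t (h :: L) = t * (h * (a : G)⁻¹) *
            (t * ((s : G)⁻¹ * (a : G)⁻¹ * (s : G)⁻¹) * t * (a : G)⁻¹ *
              (t⁻¹ * alternating t L')) * k := by
          rw [alternating, he, h4]
          simp only [mul_assoc]
        match L' with
        | [] =>
          refine ⟨[s⁻¹ * a⁻¹ * s⁻¹], a⁻¹ * k, by simpa [eq_comm] using hL', ?_⟩
          rw [h6, alternating, inv_mul_cancel]
          simp [alternating, mul_assoc]
        | c :: L' =>
          refine ⟨(s⁻¹ * a⁻¹ * s⁻¹) :: (a⁻¹ * c) :: L', k, by simpa using hL', ?_⟩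
          rw [h6, alternating, ← mul_assoc t⁻¹, inv_mul_cancel_left]
          simp [alternating, mul_assoc]

theorem isShort_alternating [Finite H] (hexp : ∀ g : G, g ^ 4 = 1) {t : G} (ht : t * t ∈ H)
    (L : List H) : IsShort H t (Nat.card H) (alternating t L) := by
  obtain ⟨n, hn⟩ : ∃ n, L.length = n := ⟨_, rfl⟩
  induction n using Nat.strong_induction_on generalizing L with
  | _ n ih =>
    rcases isShort_or_exists_finset hexp ⟨_, ht⟩ rfl L with
      (hL | ⟨k, L', k', hL', he⟩) | ⟨A, hA, hA1, -⟩
    · exact Or.inl hL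
    · rw [he]
      exact (ih _ (hn ▸ hL') L' rfl).mul_mul k k'
    · refine Or.inr ⟨1, L, 1, hA.trans_lt ?_, by simp⟩
      have := Fintype.ofFinite H
      rw [Nat.card_eq_fintype_card]
      exact Finset.card_lt_univ_of_notMem hA1

theorem finite_closure_insert (H : Subgroup G) [Finite H] (hexp : ∀ g : G, g ^ 4 = 1) (t : G)
    (ht : t * t ∈ H) : Finite (Subgroup.closure (insert t (H : Set G))) := by
  have hshort : ∀ g ∈ Subgroup.closure (insert t (H : Set G)), IsShort H t (Nat.card H) g := by
    have hmul : ∀ g, IsShort H t (Nat.card H) g → IsShort H t (Nat.card H) (g * t) := by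
      rintro g (hg | ⟨k, L, k', -, rfl⟩)
      · simpa [alternating] using (isShort_alternating hexp ht []).mul_mul ⟨g, hg⟩ 1
      · simpa [alternating_append, mul_assoc] using
          (isShort_alternating hexp ht (L ++ [k'])).mul_mul k 1
    intro g hg
    induction hg using Subgroup.closure_induction_right with
    | one => exact Or.inl H.one_mem
    | mul_right x _ y hy hx =>
      rcases hy with rfl | hy
      · exact hmul x hx
      · simpa using hx.mul_mul 1 ⟨y, hy⟩
    | mul_inv_cancel x _ y hy hx =>
      rcases hy with rfl | hy
      · simpa [mul_assoc] using (hmul x hx).mul_mul 1 (⟨_, ht⟩⁻¹ : H)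
      · simpa using hx.mul_mul 1 (⟨y, hy⟩⁻¹ : H)
  have hfin : ((H : Set G) ∪ (fun p : H × List H × H => (p.1 : G) * alternating t p.2.1 * p.2.2) ''
      (Set.univ ×ˢ {L : List H | L.length < Nat.card H} ×ˢ Set.univ)).Finite :=
    (Set.toFinite _).union (((Set.toFinite _).prod
      ((List.finite_length_lt H _).prod (Set.toFinite _))).image _)
  refine (hfin.subset fun g hg => ?_).to_subtype
  rcases hshort g hg with hg | ⟨k, L, k', hL, rfl⟩
  · exact Or.inl hg
  · exact Or.inr ⟨(k, L, k'), ⟨trivial, hL, trivial⟩, rfl⟩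

/-- Three-generator groups of exponent four are finite. -/
theorem finite_closure_triple (hexp : ∀ g : G, g ^ 4 = 1) (a b c : G) :
    Finite (Subgroup.closure {a, b, c}) := by
  have hstep : ∀ (H : Subgroup G), Finite H → ∀ g : G,
      ∃ K : Subgroup G, Finite K ∧ H ≤ K ∧ g ∈ K := by
    intro H _ g
    have h1 := finite_closure_insert H hexp (g * g)
      (by
        have h4 : g * g * (g * g) = 1 := by simpa [pow_succ, mul_assoc] using hexp g
        exact h4 ▸ H.one_mem)
    have h2 := finite_closure_insert (Subgroup.closure (insert (g * g) (H : Set G))) hexp g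
      (Subgroup.subset_closure (Set.mem_insert _ _))
    exact ⟨_, h2, fun x hx => Subgroup.subset_closure (Set.mem_insert_of_mem _
      (Subgroup.subset_closure (Set.mem_insert_of_mem _ hx))),
      Subgroup.subset_closure (Set.mem_insert _ _)⟩
  obtain ⟨K₁, f₁, -, h₁⟩ := hstep ⊥ inferInstance a
  obtain ⟨K₂, f₂, h₁₂, h₂⟩ := hstep K₁ f₁ b
  obtain ⟨K₃, f₃, h₂₃, h₃⟩ := hstep K₂ f₂ c
  have hle : Subgroup.closure {a, b, c} ≤ K₃ := by
    rw [Subgroup.closure_le]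
    rintro x (rfl | rfl | rfl)
    exacts [h₂₃ (h₁₂ h₁), h₂₃ h₂, h₃]
  exact Finite.of_injective _ (Subgroup.inclusion_injective hle)

end LocallyFinite

/-! ### A power-commutator presentation and its collection process -/

namespace PcPresentation

/-- The nontrivial right-hand sides of a power-commutator presentation of 2-power order on the
generators `0, …, 40`: the entry `(i, w)` in row `j` stands for `j * i = i * j * w` if `i < j`
and for `i * i = w` if `i = j`. -/
def rows : List (List (ℕ × List ℕ)) :=
  [[(0, [3])], [(0, [4]), (1, [5])], [(0, [6]), (1, [7]), (2, [8])], [(1, [9]), (2, [10])],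
   [(0, [9, 17]), (1, [11]), (2, [12]), (4, [17])], [(0, [11, 17]), (2, [13]), (4, [17])],
   [(0, [10, 18]), (1, [14]), (2, [15]), (4, [19]), (5, [20]), (6, [18])],
   [(0, [12, 14, 21]), (1, [13, 22]), (2, [16]), (4, [23]), (5, [24]), (6, [19, 21, 23, 29]),
      (7, [22, 30])],
   [(0, [15, 18]), (1, [16, 22, 31]), (4, [20, 21, 32]), (5, [25]), (6, [18]), (7, [22, 24, 25,
      30])],
   [(2, [26])], [(1, [26])], [(1, [17]), (2, [27]), (6, [33]), (7, [34]), (8, [29, 33, 38])],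
   [(0, [19, 26, 35]), (1, [23, 27, 29, 33, 34, 35, 40]), (2, [20, 21, 32, 33, 35]), (4, [33]),
      (5, [34, 35, 40]), (7, [29, 33, 35]), (8, [33, 35]), (12, [33, 35])],
   [(0, [20, 27, 29, 33, 35, 39]), (1, [24, 30]), (2, [25, 30]), (4, [34]), (5, [30]), (6, [29,
      39]), (7, [30]), (8, [30]), (12, [40]), (13, [30])],
   [(0, [19, 26, 36]), (1, [20, 33, 35]), (2, [28]), (5, [33, 35]), (6, [33, 35, 36]), (7,
   [37]), (8, [32, 33, 34, 35, 36, 37, 38, 39, 40]), (13, [39]), (14, [33, 35])],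
   [(1, [19, 21, 23, 28, 29, 32, 33, 34, 35, 40]), (2, [18]), (4, [33, 35, 36]), (5, [36, 37,
      38, 40]), (7, [32, 33, 34, 35, 37, 38, 39]), (13, [38, 39])],
   [(0, [19, 20, 23, 28, 34, 39, 40]), (1, [25, 30, 31]), (2, [22, 24, 25, 31]), (4, [33, 35,
      37, 38]), (5, [30, 31]), (6, [32, 33, 34, 35, 37, 40]), (7, [30, 31]), (8, [30, 31]), (11,
   [39]), (12, [38, 39, 40]), (16, [30, 31])],
   [(2, [35])], [(1, [36])], [(1, [33]), (2, [33, 35, 36])],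
   [(0, [33]), (1, [33, 35]), (2, [29, 36, 37, 40]), (7, [39]), (8, [38, 39]), (16, [40])],
   [(0, [35, 36]), (1, [29, 33, 37, 38, 39, 40]), (2, [29, 33, 35, 36, 37, 38]), (5, [39, 40]),
      (7, [38, 40]), (8, [38, 39, 40]), (13, [40]), (16, [40])],
   [(0, [29, 33, 35, 37, 38, 40]), (4, [39, 40]), (6, [38, 39, 40]), (12, [40]), (14, [40])],
   [(0, [33]), (1, [39, 40]), (2, [29, 37, 39]), (7, [39, 40]), (8, [38, 39, 40]), (16, [40])],
   [(0, [33, 39]), (1, [30]), (2, [31]), (6, [40])],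
   [(0, [29, 33, 36, 37, 40]), (1, [30, 31]), (2, [30]), (4, [39]), (6, [38, 39]), (12, [40]),
      (14, [40])],
   [], [(0, [33]), (1, [34, 35, 40]), (2, [29, 33, 38]), (7, [40]), (16, [40])],
   [(1, [29, 36, 38]), (2, [32, 33, 34, 35, 36, 37, 38, 39, 40]), (5, [39]), (7, [38, 39, 40])],
   [(1, [39, 40]), (2, [40]), (7, [40])], [], [],
   [(1, [38, 39]), (2, [38, 40]), (5, [40]), (7, [40]), (8, [40])], [], [(2, [39]), (8, [40])],
   [], [], [(1, [40]), (2, [38, 39, 40]), (7, [40])], [(1, [40]), (2, [40])], [(2, [40])], []]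

/-- The entry `(j, i)` at position `k` indicates that the relation of the pair `(j, i)` may be
regarded as the definition of the generator `k + 3`. -/
def definingPairs : List (ℕ × ℕ) :=
  [(0, 0), (1, 0), (1, 1), (2, 0), (2, 1), (2, 2), (3, 1), (3, 2), (4, 1), (4, 2), (5, 2),
   (6, 1), (6, 2), (7, 2), (4, 0), (6, 0), (6, 4), (6, 5), (7, 0), (7, 1), (7, 4), (7, 5),
   (8, 5), (9, 2), (11, 2), (14, 2), (7, 6), (7, 7), (8, 1), (8, 4), (11, 6), (11, 7), (12, 0),
   (14, 0), (14, 7), (11, 8), (13, 0), (12, 1)]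

/-- Words whose fourth powers are used. -/
def powerWords : List (List ℕ) :=
  [[0], [1], [2], [4], [6], [7], [13], [0, 1], [0, 2], [0, 5], [0, 7], [0, 8], [1, 2], [1, 6],
   [1, 8], [1, 12], [1, 15], [1, 21], [1, 28], [2, 4], [2, 5], [2, 11], [2, 14], [2, 20], [2,
   23], [4, 6], [4, 7], [4, 8], [5, 6], [5, 7], [5, 8], [0, 1, 2], [0, 1, 6], [0, 1, 8], [0, 1,
   13], [0, 2, 4], [0, 2, 5], [0, 2, 11], [0, 2, 14], [0, 5, 8], [0, 7, 8], [1, 2, 4], [1, 2,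
   8], [1, 2, 11], [1, 2, 14], [1, 6, 8], [2, 4, 5], [0, 1, 2, 7], [0, 1, 2, 8]]

/-- The triples `(k, j, i)` of generators, encoded as `(41 * k + j) * 41 + i`, whose associativity
relations are used. -/
def triples : List ℕ :=
  [0, 1681, 1722, 1723, 3362, 3403, 3404, 3444, 3445, 3446, 5084, 5085, 5125, 5126, 5127, 5167,
   5168, 6766, 6806, 6807, 6808, 6888, 6890, 6891, 6892, 8405, 8487, 8488, 8489, 8530, 8570,
   8571, 8610, 8612, 8614, 10127, 10128, 10169, 10170, 10210, 10251, 10252, 10254, 10291,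
   10292, 10293, 10294, 10295, 10296, 10332, 10333, 10335, 10336, 10337, 10338, 11767, 11809,
   11849, 11851, 11890, 11891, 11892, 11931, 11932, 11933, 11934, 11935, 11972, 11974, 11975,
   11976, 11977, 12014, 12015, 12017, 12018, 12019, 12054, 12056, 12057, 12058, 12059, 12060,
   13448, 13490, 13572, 13613, 13614, 13615, 13616, 13653, 13656, 13657, 13658, 13695, 13696,
   13699, 13742, 13776, 13777, 13780, 13781, 13782, 13783, 15129, 15170, 15171, 15211, 15294,
   15295, 15297, 15375, 15376, 15379, 15380, 15381, 15416, 15417, 15418, 15420, 15421, 15423,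
   15457, 15462, 15500, 16810, 16851, 16852, 16892, 16893, 16894, 16976, 16978, 17015, 17017,
   17057, 17058, 17060, 17061, 17062, 17097, 17099, 17101, 17102, 17104, 17143, 17180, 17181,
   18491, 18532, 18573, 18574, 18575, 18616, 18657, 18659, 18698, 18737, 18738, 18739, 18742,
   18778, 18780, 18782, 18783, 18824, 18862, 18866, 18867, 18903, 18907, 18908, 18944, 20172,
   20214, 20418, 20420, 20422, 20423, 20424, 20461, 20504, 20625, 20627, 20629, 20666, 20668,
   20672, 21895, 21937, 22019, 22063, 22100, 22101, 22104, 22105, 22147, 22182, 22185, 22189,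
   22228, 22269, 22308, 22354, 22355, 22356, 22386, 22389, 22393, 22395, 22396, 22397, 22399,
   23616, 23617, 23618, 23698, 23700, 23702, 23741, 23782, 23823, 23825, 23828, 23910, 23946,
   23951, 23987, 24028, 24030, 24033, 24069, 24076, 24077, 24078, 24079, 24110, 25215, 25297,
   25381, 25466, 25467, 25504, 25548, 25668, 25672, 25757, 25758, 25759, 25791, 25796, 25834,
   25835, 26896, 26938, 26980, 27106, 27143, 27226, 27440, 27442, 27472, 27477, 27481, 27483,
   27522, 27524, 27558, 27561, 27562, 27565, 27568, 28659, 28660, 28661, 28743, 28829, 28865,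
   28866, 28871, 28905, 28910, 28989, 29123, 30299, 30300, 30341, 30463, 30465, 30547, 30550,
   30552, 30591, 30628, 30804, 31939, 31981, 32022, 32023, 32107, 32144, 32186, 32190, 32191,
   32227, 32228, 32230, 32231, 32233, 32267, 32272, 32396, 32397, 32484, 32485, 32520, 32526,
   32611, 33662, 33702, 33704, 33788, 33867, 33872, 33909, 33912, 33953, 34077, 34157, 34165,
   34166, 34207, 34243, 34289, 34290, 34291, 35343, 35469, 35548, 35551, 35552, 35553, 35590,
   35592, 35595, 35758, 35838, 36170, 37024, 37064, 37065, 37066, 37147, 37148, 37150, 37229,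
   37230, 37233, 37271, 37273, 37435, 37528, 37558, 37570, 37652, 37654, 37855, 38704, 38705,
   38745, 38746, 38747, 38829, 38831, 38870, 38911, 38914, 38915, 38952, 38996, 39120, 39200,
   39202, 39208, 39209, 39239, 39250, 39335, 40344, 40386, 40426, 40510, 40512, 40551, 40591,
   40592, 40633, 40635, 40637, 40638, 40677, 40797, 40802, 40840, 40842, 40889, 40890, 40920,
   40925, 40931, 41016, 42025, 42067, 42109, 42191, 42232, 42277, 42314, 42319, 42357, 42483,
   42571, 42692, 42697, 42861, 42890, 42892, 43706, 43747, 43748, 43788, 43789, 43790, 43871,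
   43872, 43874, 43913, 43953, 43954, 43956, 43957, 43958, 43993, 43995, 43997, 43998, 44000,
   44038, 44039, 44159, 44163, 44164, 44245, 44251, 44252, 44282, 44287, 44293, 44334, 44378,
   44405, 44445, 45429, 45469, 45471, 45553, 45555, 45592, 45594, 45634, 45637, 45638, 45639,
   45675, 45676, 45678, 45680, 45681, 45720, 45844, 45924, 45926, 45932, 45933, 45968, 45974,
   46015, 46059, 46495, 46496, 47068, 47109, 47110, 47150, 47152, 47232, 47236, 47273, 47315,
   47318, 47319, 47320, 47396, 47397, 47400, 47401, 47525, 47605, 47607, 47613, 47614, 47655,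
   47696, 47728, 47740, 48218, 48749, 48790, 48791, 48831, 48832, 48833, 48915, 48917, 48954,
   48956, 48996, 48999, 49000, 49001, 49038, 49041, 49043, 49077, 49081, 49082, 49206, 49249,
   49286, 49294, 49295, 49336, 49377, 49421, 49610, 50471, 50512, 50596, 50677, 50678, 50717,
   52111, 52152, 52153, 52193, 52194, 52195, 52276, 52277, 52279, 52358, 52359, 52362, 52363,
   52398, 52657, 53792, 53833, 53834, 53874, 53875, 53876, 53956, 53957, 53958, 53960, 53999,
   54038, 54040, 54042, 54043, 54044, 54083, 54084, 54086, 54124, 54125, 54245, 54249, 54284,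
   54329, 54331, 54337, 54338, 54366, 54368, 54373, 54379, 54420, 54464, 55473, 55514, 55515,
   55555, 55556, 55557, 55641, 55680, 55725, 55762, 55767, 55806, 55931, 55977, 56018, 56019,
   56054, 56060, 56145, 56212, 57154, 57195, 57196, 57236, 57238, 57320, 57322, 57401, 57402,
   57406, 57442, 57448, 57483, 57699, 57700, 57735, 57741, 57826, 57893, 58835, 58876, 58877,
   58917, 58918, 58919, 58959, 59000, 59001, 59003, 59042, 59082, 59083, 59085, 59086, 59087,
   59122, 59124, 59126, 59127, 59129, 59168, 59288, 59293, 59380, 59381, 59411, 59416, 59422,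
   59463, 59507, 59574, 60516, 60557, 60558, 60598, 60599, 60600, 60641, 60681, 60682, 60684,
   60723, 60763, 60764, 60766, 60767, 60768, 60803, 60805, 60807, 60808, 60810, 60849, 60969,
   61061, 61062, 61092, 61097, 61103, 61144, 61188, 62197, 62238, 62239, 62279, 62281, 62365,
   62402, 62444, 62448, 62449, 62485, 62488, 62491, 62525, 62529, 62530, 62736, 62742, 62743,
   62784, 62869, 63878, 63919, 63920, 63961, 63962, 64044, 64046, 64085, 64125, 64128, 64129,
   64130, 64169, 64170, 64172, 64211, 64335, 64336, 64423, 64424, 64459, 64465, 64550, 65559,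
   65600, 65601, 65642, 65643, 65727, 65811, 65853, 66104, 66105, 66231, 67240, 67281, 67282,
   67322, 67324, 67408, 67492, 67534, 67786, 67912]

/-- Words `x` for which the Engel relation `[3, x, x] = 1` is used. -/
def engelWords : List (List ℕ) :=
  [[1], [2], [0, 1], [0, 2], [1, 2], [1, 6], [1, 7], [1, 8]]

/-- The row of index `j`, empty when out of range. -/
def rowAt : List (List (ℕ × List ℕ)) → ℕ → List (ℕ × List ℕ)
  | [], _ => []
  | r :: _, 0 => r
  | _ :: rs, j + 1 => rowAt rs j

/-- The word with label `i` in a row, empty when there is none. -/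
def wordAt : List (ℕ × List ℕ) → ℕ → List ℕ
  | [], _ => []
  | (k, w) :: r, i => bif Nat.beq k i then w else wordAt r i

/-- The word on the right-hand side of the relation of the pair `(j, i)`. -/
def rule (j i : ℕ) : List ℕ := wordAt (rowAt rows j) i

/-- The index of the relation of the pair `(j, i)`. -/
def key (j i : ℕ) : ℕ := Nat.add (Nat.mul 41 j) i

/-- Collect the word `e.reverse ++ st`, where `e.reverse` is already in normal form, recording
the keys of the relations that are used. -/
def collect : ℕ → List ℕ → List ℕ → List ℕ → List ℕ × List ℕ
  | 0, e, st, ks => (e.reverseAux st, ks)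
  | _ + 1, e, [], ks => (e.reverseAux [], ks)
  | n + 1, [], i :: st, ks => collect n [i] st ks
  | n + 1, j :: e, i :: st, ks =>
    bif Nat.ble i j then
      bif Nat.beq i j then collect n e (List.append (rule j i) st) (key j i :: ks)
      else collect n e (i :: j :: (List.append (rule j i) st)) (key j i :: ks)
    else collect n (i :: j :: e) st ks

/-- The bit mask of the sum modulo 2 of a list of keys, added to `m`. -/
def toMask : List ℕ → ℕ → ℕ
  | [], m => m
  | k :: ks, m => Nat.xor (toMask ks m) (Nat.pow 2 k)

/-- Equality of words. -/
def eqWord : List ℕ → List ℕ → Bool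
  | [], [] => true
  | a :: l, b :: r => bif Nat.beq a b then eqWord l r else false
  | [], _ :: _ => false
  | _ :: _, [] => false

/-- The mask of the keys that differ in two collected words; zero if the words differ. -/
def maskAux : List ℕ × List ℕ → List ℕ × List ℕ → ℕ
  | (e, ks), (e', ks') => bif eqWord e e' then toMask ks (toMask ks' 0) else 0

/-- The mask of the keys that differ in the collections of two words, the second one coming with
a list of keys; zero if the normal forms differ. -/
def mask (l r ks : List ℕ) : ℕ := maskAux (collect 6000 [] l []) (collect 6000 [] r ks)

/-- The mask of an associativity relation. -/
def assocMask (k j i : ℕ) : ℕ :=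
  bif Nat.beq i j then mask [k, j, i] (k :: rule j i) [key j i]
  else bif Nat.ble i j then mask [k, j, i] (k :: i :: j :: rule j i) [key j i]
  else 0

/-- Masks of associativity relations. -/
def assocMasks : List ℕ :=
  triples.map fun c => assocMask (Nat.div c 1681) (Nat.mod (Nat.div c 41) 41) (Nat.mod c 41)

/-- Masks of fourth power relations. -/
def powerMasks : List ℕ := powerWords.map fun x => mask (x ++ (x ++ (x ++ x))) [] []

/-- Masks of Engel relations. -/
def engelMasks : List ℕ :=
  engelWords.map fun x =>
    mask (3 :: (x ++ (x ++ (x ++ 3 :: x)))) (x ++ 3 :: (x ++ (x ++ (x ++ [3])))) []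

/-- The mask `t` without the bits of `z`. -/
def clear (z t : ℕ) : ℕ := Nat.xor t (Nat.land t z)

/-- Remove the bits of `z` from the masks in a list, adding to `z` the bits that become
isolated; returns the new `z` and the remaining masks. -/
def sweep : List ℕ → ℕ → List ℕ → ℕ × List ℕ
  | [], z, ms => (z, ms)
  | t :: ts, z, ms =>
    bif Nat.beq (clear z t) 0 then sweep ts z ms
    else bif Nat.beq (Nat.land (clear z t) (Nat.sub (clear z t) 1)) 0 then
      sweep ts (Nat.lor z (clear z t)) ms
    else sweep ts z (clear z t :: ms)

/-- The lowest bit of `b`. -/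
def lowBit (b : ℕ) : ℕ := Nat.xor b (Nat.land b (Nat.sub b 1))

/-- Clear the lowest bits of the rows in `bs` from the mask `t`, starting from the end. -/
def reduce : List ℕ → ℕ → ℕ
  | [], t => t
  | b :: bs, t =>
    bif Nat.beq (Nat.land (reduce bs t) (lowBit b)) 0 then reduce bs t
    else Nat.xor (reduce bs t) b

/-- Gaussian elimination. -/
def gauss (z : ℕ) : List ℕ → List ℕ → List ℕ
  | [], bs => bs
  | t :: ts, bs =>
    bif Nat.beq (reduce bs (clear z t)) 0 then gauss z ts bs
    else gauss z ts (reduce bs (clear z t) :: bs)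

/-- Repeated sweeps and a final elimination. -/
def solve : ℕ → ℕ × List ℕ → ℕ
  | 0, (z, ms) => (sweep (gauss z ms []) z []).1
  | n + 1, (z, ms) => solve n (sweep ms z [])

/-- The mask of the keys of all relations. -/
def fullMask : ℕ :=
  toMask ((List.range 41).flatMap fun j => (List.range (j + 1)).map fun i => key j i) 0

/-- The mask of the keys of the defining pairs. -/
def definingMask : ℕ := toMask (definingPairs.map fun p => key p.1 p.2) 0

/-! ### Soundness of the collection process with central tails -/

section Soundness

open scoped IsMulCommutative

variable {G : Type*} [Group G] (h : ℕ → G)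

/-- The right-hand side of the relation of the pair `(j, i)`. -/
def rhs (j i : ℕ) : G :=
  if i = j then ((rule j i).map h).prod else h i * h j * ((rule j i).map h).prod

variable {h} {T : ℕ → Subgroup.center G}

theorem prod_mul_prod_collect (hT : ∀ k, T k * T k = 1)
    (hrel : ∀ j i, i ≤ j → h j * h i = rhs h j i * T (key j i)) (n : ℕ) (e st ks : List ℕ) :
    ((e.reverse ++ st).map h).prod * ((ks.map T).prod : Subgroup.center G) =
      ((collect n e st ks).1.map h).prod *
        (((collect n e st ks).2.map T).prod : Subgroup.center G) := by
  induction n generalizing e st ks with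
  | zero => simp [collect, List.reverseAux_eq]
  | succ n ih =>
    match e, st with
    | e, [] => simp [collect, List.reverseAux_eq]
    | [], i :: st => rw [collect, ← ih]; simp
    | j :: e, i :: st =>
      have key_step (hij : i ≤ j) (A B : G) :
          A * (h j * (h i * B)) * ((ks.map T).prod : Subgroup.center G) =
            A * (rhs h j i * B) * (((key j i :: ks).map T).prod : Subgroup.center G) := by
        have hc := fun g => (Subgroup.mem_center_iff.1 (T (key j i)).2 g)
        have h2 : (T (key j i) : G) * T (key j i) = 1 := congrArg Subtype.val (hT (key j i))
        rw [← mul_assoc (h j), hrel j i hij, List.map_cons, List.prod_cons, Subgroup.coe_mul]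
        simp only [mul_assoc]
        rw [← mul_assoc (T (key j i) : G) B, ← hc B]
        simp only [mul_assoc]
      rw [collect]
      rcases Nat.lt_trichotomy i j with hij | hij | hij
      · have h1 : Nat.ble i j = true := Nat.ble_eq_true_of_le hij.le
        have h2 : Nat.beq i j = false := by
          rw [← Bool.not_eq_true, Nat.beq_eq]; exact hij.ne
        rw [h1, h2, cond_true, cond_false, ← ih]
        have := key_step hij.le (e.reverse.map h).prod (st.map h).prod
        rw [rhs, if_neg hij.ne] at this
        simpa [mul_assoc] using this
      · subst hij
        have h1 : Nat.ble i i = true := Nat.ble_eq_true_of_le le_rfl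
        have h2 : Nat.beq i i = true := Nat.beq_refl i
        rw [h1, h2, cond_true, cond_true, ← ih]
        have := key_step le_rfl (e.reverse.map h).prod (st.map h).prod
        rw [rhs, if_pos rfl] at this
        simpa [mul_assoc] using this
      · have h1 : Nat.ble i j = false := by
          rw [← Bool.not_eq_true, Nat.ble_eq]; exact hij.not_ge
        rw [h1, cond_false, ← ih]
        simp

theorem eq_of_eqWord : ∀ l r : List ℕ, eqWord l r = true → l = r
  | [], [], _ => rfl
  | a :: l, b :: r, H => by
    rw [eqWord] at H
    cases hab : Nat.beq a b <;> rw [hab] at H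
    · exact absurd H (by simp)
    · rw [Nat.eq_of_beq_eq_true hab, eq_of_eqWord l r H]
  | [], _ :: _, H => absurd H (by simp [eqWord])
  | _ :: _, [], H => absurd H (by simp [eqWord])

/-- The product of the elements `T k` over the bits `k` of `m`. -/
def evalMask (T : ℕ → Subgroup.center G) (m : ℕ) : Subgroup.center G :=
  ∏ k ∈ Finset.range 1681, if m.testBit k then T k else 1

theorem evalMask_zero : evalMask T 0 = 1 := by simp [evalMask]

theorem evalMask_xor (hT : ∀ k, T k * T k = 1) (a b : ℕ) :
    evalMask T (Nat.xor a b) = evalMask T a * evalMask T b := by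
  rw [evalMask, evalMask, evalMask, ← Finset.prod_mul_distrib]
  refine Finset.prod_congr rfl fun k _ => ?_
  change (if (a ^^^ b).testBit k then T k else 1) = _
  rw [Nat.testBit_xor]
  cases a.testBit k <;> cases b.testBit k <;> simp [hT]

theorem evalMask_two_pow (hbig : ∀ k, 1681 ≤ k → T k = 1) (k : ℕ) :
    evalMask T (Nat.pow 2 k) = T k := by
  change evalMask T (2 ^ k) = T k
  simp only [evalMask, Nat.testBit_two_pow, decide_eq_true_eq, Finset.prod_ite_eq,
    Finset.mem_range]
  split_ifs with hk
  · rfl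
  · exact (hbig k (not_lt.1 hk)).symm

theorem evalMask_toMask (hT : ∀ k, T k * T k = 1) (hbig : ∀ k, 1681 ≤ k → T k = 1)
    (ks : List ℕ) (m : ℕ) : evalMask T (toMask ks m) = (ks.map T).prod * evalMask T m := by
  induction ks with
  | nil => simp [toMask]
  | cons k ks ih =>
    rw [toMask, evalMask_xor hT, evalMask_two_pow hbig, ih, List.map_cons, List.prod_cons,
      mul_comm, mul_assoc]

theorem evalMask_mask (hT : ∀ k, T k * T k = 1) (hbig : ∀ k, 1681 ≤ k → T k = 1)
    (hrel : ∀ j i, i ≤ j → h j * h i = rhs h j i * T (key j i)) {l r ks : List ℕ}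
    (H : (l.map h).prod = (r.map h).prod * ((ks.map T).prod : Subgroup.center G)) :
    evalMask T (mask l r ks) = 1 := by
  have h1 := prod_mul_prod_collect hT hrel 6000 [] l []
  have h2 := prod_mul_prod_collect hT hrel 6000 [] r ks
  rw [mask]
  generalize collect 6000 [] l [] = p at h1 ⊢
  generalize collect 6000 [] r ks = q at h2 ⊢
  obtain ⟨e, k₁⟩ := p
  obtain ⟨e', k₂⟩ := q
  rw [maskAux]
  cases he : eqWord e e'
  · exact evalMask_zero
  · rw [cond_true, evalMask_toMask hT hbig, evalMask_toMask hT hbig, evalMask_zero, mul_one]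
    obtain rfl := eq_of_eqWord _ _ he
    simp only [List.reverse_nil, List.nil_append, List.map_nil, List.prod_nil,
      Subgroup.coe_one, mul_one] at h1 h2
    rw [← H, h1] at h2
    have h3 : (k₁.map T).prod = (k₂.map T).prod := Subtype.ext (mul_left_cancel h2)
    rw [h3, ← List.prod_map_mul]
    simp [hT]

theorem evalMask_assocMask (hT : ∀ k, T k * T k = 1) (hbig : ∀ k, 1681 ≤ k → T k = 1)
    (hrel : ∀ j i, i ≤ j → h j * h i = rhs h j i * T (key j i)) (k j i : ℕ) :
    evalMask T (assocMask k j i) = 1 := by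
  rw [assocMask]
  cases hij : Nat.beq i j
  · rw [cond_false]
    cases hle : Nat.ble i j
    · exact evalMask_zero
    · rw [cond_true]
      have hne : i ≠ j := fun he => by rw [he, Nat.beq_refl] at hij; exact absurd hij (by simp)
      apply evalMask_mask hT hbig hrel
      have := hrel j i (Nat.le_of_ble_eq_true hle)
      rw [rhs, if_neg hne] at this
      simp [this, mul_assoc]
  · rw [cond_true]
    obtain rfl := Nat.eq_of_beq_eq_true hij
    apply evalMask_mask hT hbig hrel
    have := hrel i i le_rfl
    rw [rhs, if_pos rfl] at this
    simp [this, mul_assoc]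

/-! ### Soundness of the elimination process -/

/-- The mask `z` only has bits `k` with `T k = 1`. -/
def IsNull (T : ℕ → Subgroup.center G) (z : ℕ) : Prop := ∀ k, z.testBit k = true → T k = 1

theorem evalMask_clear {z t : ℕ} (hz : IsNull T z) : evalMask T (clear z t) = evalMask T t := by
  refine Finset.prod_congr rfl fun k _ => ?_
  change (if (t ^^^ (t &&& z)).testBit k then T k else 1) = _
  rw [Nat.testBit_xor, Nat.testBit_and]
  cases htk : t.testBit k <;> cases hzk : z.testBit k <;> simp [hz k, *]

theorem isNull_lor {z s : ℕ} (hz : IsNull T z) (hs : IsNull T s) : IsNull T (Nat.lor z s) := by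
  intro k hk
  change (z ||| s).testBit k = true at hk
  rw [Nat.testBit_or, Bool.or_eq_true] at hk
  exact hk.elim (hz k) (hs k)

theorem isNull_of_isolated (hbig : ∀ k, 1681 ≤ k → T k = 1) {s : ℕ} (hs : evalMask T s = 1)
    (h0 : s ≠ 0) (h1 : Nat.beq (Nat.land s (Nat.sub s 1)) 0 = true) : IsNull T s := by
  obtain ⟨k, rfl⟩ := (Nat.and_sub_one_eq_zero_iff_isPowerOfTwo h0).1 (Nat.eq_of_beq_eq_true h1)
  intro i hi
  rw [Nat.testBit_two_pow, decide_eq_true_eq] at hi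
  rw [← hi, ← evalMask_two_pow hbig k]
  exact hs

theorem sweep_sound (hbig : ∀ k, 1681 ≤ k → T k = 1) (ts : List ℕ) :
    ∀ (z : ℕ) (ms : List ℕ), IsNull T z → (∀ t ∈ ts, evalMask T t = 1) →
      (∀ t ∈ ms, evalMask T t = 1) →
      IsNull T (sweep ts z ms).1 ∧ ∀ t ∈ (sweep ts z ms).2, evalMask T t = 1 := by
  induction ts with
  | nil => intro z ms hz _ hms; exact ⟨hz, hms⟩
  | cons t ts ih =>
    intro z ms hz hts hms
    have ht : evalMask T (clear z t) = 1 := by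
      rw [evalMask_clear hz]; exact hts t List.mem_cons_self
    have hts' : ∀ t ∈ ts, evalMask T t = 1 := fun s hs => hts s (List.mem_cons_of_mem _ hs)
    rw [sweep]
    cases h0 : Nat.beq (clear z t) 0
    · cases h1 : Nat.beq (Nat.land (clear z t) (Nat.sub (clear z t) 1)) 0
      · exact ih z _ hz hts' (List.forall_mem_cons.2 ⟨ht, hms⟩)
      · refine ih _ ms (isNull_lor hz (isNull_of_isolated hbig ht ?_ h1)) hts' hms
        intro he
        rw [he] at h0
        exact absurd h0 (by simp)
    · exact ih z ms hz hts' hms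

theorem evalMask_reduce (hT : ∀ k, T k * T k = 1) {t : ℕ} (ht : evalMask T t = 1) (bs : List ℕ)
    (hbs : ∀ b ∈ bs, evalMask T b = 1) : evalMask T (reduce bs t) = 1 := by
  induction bs with
  | nil => exact ht
  | cons b bs ih =>
    obtain ⟨hb, hbs⟩ := List.forall_mem_cons.1 hbs
    rw [reduce]
    cases Nat.beq (Nat.land (reduce bs t) (lowBit b)) 0
    · rw [cond_false, evalMask_xor hT, ih hbs, hb, mul_one]
    · exact ih hbs

theorem evalMask_gauss (hT : ∀ k, T k * T k = 1) {z : ℕ} (hz : IsNull T z) (ts : List ℕ) :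
    ∀ bs : List ℕ, (∀ t ∈ ts, evalMask T t = 1) → (∀ b ∈ bs, evalMask T b = 1) →
      ∀ t ∈ gauss z ts bs, evalMask T t = 1 := by
  induction ts with
  | nil => intro bs _ hbs; exact hbs
  | cons t ts ih =>
    intro bs hts hbs
    obtain ⟨ht, hts⟩ := List.forall_mem_cons.1 hts
    rw [gauss]
    cases Nat.beq (reduce bs (clear z t)) 0
    · refine ih _ hts (List.forall_mem_cons.2 ⟨evalMask_reduce hT ?_ bs hbs, hbs⟩)
      rw [evalMask_clear hz]; exact ht
    · exact ih bs hts hbs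

theorem isNull_solve (hT : ∀ k, T k * T k = 1) (hbig : ∀ k, 1681 ≤ k → T k = 1) (n : ℕ) :
    ∀ (z : ℕ) (ms : List ℕ), IsNull T z → (∀ t ∈ ms, evalMask T t = 1) →
      IsNull T (solve n (z, ms)) := by
  induction n with
  | zero =>
    intro z ms hz hms
    exact (sweep_sound hbig _ z [] hz (evalMask_gauss hT hz ms [] hms (by simp)) (by simp)).1
  | succ n ih =>
    intro z ms hz hms
    obtain ⟨h1, h2⟩ := sweep_sound hbig ms z [] hz hms (by simp)
    exact ih _ _ h1 h2

theorem mem_of_testBit_toMask (i : ℕ) (ks : List ℕ) (hi : (toMask ks 0).testBit i = true) :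
    i ∈ ks := by
  induction ks with
  | nil => simp [toMask] at hi
  | cons k ks ih =>
    change (toMask ks 0 ^^^ 2 ^ k).testBit i = true at hi
    rw [Nat.testBit_xor, Nat.testBit_two_pow] at hi
    by_cases hk : k = i
    · simp [hk]
    · exact List.mem_cons_of_mem _ (ih (by simpa [hk] using hi))

/-- The bits of the mask of all relations. -/
theorem testBit_fullMask : ∀ j < 41, ∀ i ≤ j, fullMask.testBit (key j i) = true := by
  decide +kernel

set_option maxRecDepth 100000 in
/-- The recorded relations determine all the tails. -/
theorem solve_eq_fullMask :
    Nat.beq (solve 4 (definingMask, powerMasks ++ (engelMasks ++ assocMasks))) fullMask = true := by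
  decide +kernel

/-- If a group satisfies the relations of the presentation up to central tails of order at most
two, the defining relations exactly, has exponent four and satisfies the Engel relations, then all
tails are trivial. -/
theorem tail_eq_one (hT : ∀ k, T k * T k = 1) (hbig : ∀ k, 1681 ≤ k → T k = 1)
    (hrel : ∀ j i, i ≤ j → h j * h i = rhs h j i * T (key j i))
    (hdef : ∀ p ∈ definingPairs, T (key p.1 p.2) = 1) (hexp : ∀ g : G, g ^ 4 = 1)
    (hengel : ∀ g : G, h 3 * g ^ 3 * h 3 * g = g * (h 3 * g ^ 3 * h 3)) {j i : ℕ} (hj : j < 41)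
    (hi : i ≤ j) : T (key j i) = 1 := by
  have hnull : IsNull T definingMask := by
    intro k hk
    obtain ⟨p, hp, rfl⟩ := List.mem_map.1 (mem_of_testBit_toMask k _ hk)
    exact hdef p hp
  refine isNull_solve hT hbig 4 _ (powerMasks ++ (engelMasks ++ assocMasks)) hnull ?_ _ ?_
  · simp only [List.mem_append, powerMasks, engelMasks, assocMasks, List.mem_map]
    rintro t (⟨x, -, rfl⟩ | ⟨x, -, rfl⟩ | ⟨c, -, rfl⟩)
    · refine evalMask_mask hT hbig hrel ?_
      simpa [pow_succ, mul_assoc] using hexp (x.map h).prod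
    · refine evalMask_mask hT hbig hrel ?_
      simpa [pow_succ, mul_assoc] using hengel (x.map h).prod
    · exact evalMask_assocMask hT hbig hrel _ _ _
  · rw [Nat.eq_of_beq_eq_true solve_eq_fullMask]
    exact testBit_fullMask j hj i hi

end Soundness

/-! ### Finite groups satisfying the defining relations -/

theorem map_rhs {G H : Type*} [Group G] [Group H] (f : G →* H) (h : ℕ → G) (j i : ℕ) :
    f (rhs h j i) = rhs (fun k => f (h k)) j i := by
  rw [rhs, rhs]
  split_ifs <;> simp [map_list_prod, Function.comp_def]

theorem rule_of_le {j : ℕ} (hj : 41 ≤ j) (i : ℕ) : rule j i = [] := by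
  have : ∀ (rs : List (List (ℕ × List ℕ))) (j : ℕ), rs.length ≤ j → rowAt rs j = [] := by
    intro rs
    induction rs with
    | nil => intro j _; rfl
    | cons r rs ih =>
      intro j hj
      cases j with
      | zero => simp at hj
      | succ j => exact ih j (by simpa using hj)
  rw [rule, this rows j hj]
  rfl

theorem exists_central_subgroup {Q : Type*} [Group Q] [Finite Q] [Nontrivial Q]
    (hexp : ∀ g : Q, g ^ 4 = 1) :
    ∃ N : Subgroup Q, N ≤ Subgroup.center Q ∧ N ≠ ⊥ ∧ ∀ w ∈ N, w * w = 1 := by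
  have hp : IsPGroup 2 Q := fun g => ⟨2, hexp g⟩
  have := hp.center_nontrivial
  obtain ⟨⟨z, hz⟩, hz1⟩ := exists_ne (1 : Subgroup.center Q)
  have key : ∀ w ∈ Subgroup.center Q, w ≠ 1 → w * w = 1 →
      ∃ N : Subgroup Q, N ≤ Subgroup.center Q ∧ N ≠ ⊥ ∧ ∀ w ∈ N, w * w = 1 := by
    intro w hw hw1 hww
    refine ⟨Subgroup.zpowers w, by simpa using hw, by simpa using hw1, ?_⟩
    rintro _ ⟨k, rfl⟩
    change w ^ k * w ^ k = 1
    rw [← (Commute.refl w).mul_zpow, hww, one_zpow]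
  by_cases hzz : z * z = 1
  · exact key z hz (fun he => hz1 (Subtype.ext he)) hzz
  · exact key (z * z) (mul_mem hz hz) hzz (by simpa [pow_succ, mul_assoc] using hexp z)

/-- In a finite group of exponent four, the defining relations and the Engel relations for `h 3`
imply all relations of the presentation. -/
theorem mul_eq_rhs_of_finite (n : ℕ) : ∀ (Q : Type u) [Group Q] [Finite Q], Nat.card Q = n →
    (∀ g : Q, g ^ 4 = 1) → ∀ h : ℕ → Q, (∀ j, 41 ≤ j → h j = 1) →
    (∀ p ∈ definingPairs, h p.1 * h p.2 = rhs h p.1 p.2) →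
    (∀ g : Q, h 3 * g ^ 3 * h 3 * g = g * (h 3 * g ^ 3 * h 3)) →
    ∀ j i, i ≤ j → h j * h i = rhs h j i := by
  induction n using Nat.strong_induction_on with
  | _ n ih =>
    intro Q _ _ hcard hexp h hbig hdef hengel j i hij
    rcases subsingleton_or_nontrivial Q with _ | _
    · exact Subsingleton.elim _ _
    obtain ⟨N, hN, hN1, hN2⟩ := exists_central_subgroup hexp
    have hnormal : N.Normal := ⟨fun w hw g => by
      rw [Subgroup.mem_center_iff.1 (hN hw) g, mul_inv_cancel_right]; exact hw⟩
    have hlt : Nat.card (Q ⧸ N) < n := by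
      rw [← hcard, Subgroup.card_eq_card_quotient_mul_card_subgroup N]
      exact lt_mul_of_one_lt_right Nat.card_pos ((Subgroup.one_lt_card_iff_ne_bot N).2 hN1)
    have hquot := ih _ hlt (Q ⧸ N) rfl (fun g => by
        obtain ⟨g, rfl⟩ := QuotientGroup.mk'_surjective N g
        rw [← map_pow, hexp, map_one])
      (fun k => QuotientGroup.mk' N (h k)) (fun j hj => by rw [hbig j hj, map_one])
      (fun p hp => by rw [← map_mul, hdef p hp, map_rhs])
      (fun g => by
        obtain ⟨g, rfl⟩ := QuotientGroup.mk'_surjective N g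
        simpa only [map_mul, map_pow] using congrArg (QuotientGroup.mk' N) (hengel g))
    have hmem : ∀ j i, i ≤ j → (rhs h j i)⁻¹ * (h j * h i) ∈ N := by
      intro j i hij
      have := hquot j i hij
      rw [← map_mul, ← map_rhs] at this
      exact QuotientGroup.eq.1 this.symm
    by_cases hj : 41 ≤ j
    · rw [rhs, rule_of_le hj, hbig j hj]
      split_ifs with he <;> simp [he, hbig j hj]
    rw [not_le] at hj
    classical
    let T : ℕ → Subgroup.center Q := fun k =>
      if hk : k < 1681 ∧ k % 41 ≤ k / 41 then
        ⟨(rhs h (k / 41) (k % 41))⁻¹ * (h (k / 41) * h (k % 41)), hN (hmem _ _ hk.2)⟩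
      else 1
    have hTkey : ∀ j i, i ≤ j → j < 41 →
        (T (key j i) : Q) = (rhs h j i)⁻¹ * (h j * h i) := by
      intro j i hij hj
      have h1 : key j i / 41 = j := by change (41 * j + i) / 41 = j; omega
      have h2 : key j i % 41 = i := by change (41 * j + i) % 41 = i; omega
      have h3 : key j i < 1681 := by change 41 * j + i < 1681; omega
      simp only [T, h1, h2]
      rw [dif_pos ⟨h3, hij⟩]
    have hTbig : ∀ k, 1681 ≤ k → T k = 1 := fun k hk => dif_neg fun hk' => hk'.1.not_ge hk
    have hpairs : ∀ p ∈ definingPairs, p.2 ≤ p.1 ∧ p.1 < 41 := by decide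
    have := tail_eq_one (h := h) (T := T) (fun k => ?_) hTbig ?_ ?_ hexp hengel hj hij
    · have h4 := hTkey j i hij hj
      rw [this, Subgroup.coe_one] at h4
      exact (inv_mul_eq_one.1 h4.symm).symm
    · simp only [T]
      split_ifs with hk
      · exact Subtype.ext (hN2 _ (hmem _ _ hk.2))
      · exact mul_one 1
    · intro j i hij
      by_cases hj : 41 ≤ j
      · have h5 : T (key j i) = 1 := hTbig _ (by change 1681 ≤ 41 * j + i; omega)
        rw [h5, rhs, rule_of_le hj, hbig j hj]
        split_ifs with he <;> simp [he, hbig j hj]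
      · rw [hTkey j i hij (not_le.1 hj), mul_inv_cancel_left]
    · intro p hp
      refine Subtype.ext ?_
      rw [hTkey _ _ (hpairs p hp).1 (hpairs p hp).2, hdef p hp, inv_mul_cancel, Subgroup.coe_one]

/-! ### Existence of generators and the commutator identity -/

theorem rhs_congr {G : Type*} [Group G] {h h' : ℕ → G} {j i : ℕ} (hj : h j = h' j)
    (hi : h i = h' i) (hk : ∀ k ∈ rule j i, h k = h' k) : rhs h j i = rhs h' j i := by
  rw [rhs, rhs, hj, hi, List.map_congr_left hk]

theorem definingPairs_lt : ∀ m < 38, ∀ p ∈ definingPairs.take m,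
    p.1 < m + 3 ∧ p.2 < m + 3 ∧ ∀ k ∈ rule p.1 p.2, k < m + 3 := by
  decide +kernel

theorem rule_definingPairs : ∀ m < 38, ∀ p ∈ definingPairs[m]?, p.1 < m + 3 ∧ p.2 < m + 3 ∧
    rule p.1 p.2 = (rule p.1 p.2).dropLast ++ [m + 3] ∧
      ∀ k ∈ (rule p.1 p.2).dropLast, k < m + 3 := by
  decide +kernel

theorem exists_defining_relations {G : Type*} [Group G] (a b c : G) (m : ℕ) (hm : m ≤ 38) :
    ∃ h : ℕ → G, h 0 = a ∧ h 1 = b ∧ h 2 = c ∧ (∀ j, m + 3 ≤ j → h j = 1) ∧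
      ∀ p ∈ definingPairs.take m, h p.1 * h p.2 = rhs h p.1 p.2 := by
  induction m with
  | zero =>
    refine ⟨fun k => if k = 0 then a else if k = 1 then b else if k = 2 then c else 1,
      rfl, rfl, rfl, fun j hj => ?_, by simp⟩
    simp only [show j ≠ 0 by omega, show j ≠ 1 by omega, show j ≠ 2 by omega, if_false]
  | succ m ih =>
    obtain ⟨h, h0, h1, h2, hbig, hrel⟩ := ih (by omega)
    have hlen : m < definingPairs.length := hm
    obtain ⟨p, hp⟩ : ∃ p, definingPairs[m]? = some p := ⟨_, List.getElem?_eq_getElem hlen⟩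
    obtain ⟨hp1, hp2, hw, hlt⟩ := rule_definingPairs m hm p hp
    let h' : G → ℕ → G := fun g => Function.update h (m + 3) g
    have hne : ∀ (g : G) (k : ℕ), k < m + 3 → h' g k = h k := fun g k hk =>
      Function.update_of_ne hk.ne _ _
    obtain ⟨g, hg⟩ : ∃ g, h p.1 * h p.2 = rhs (h' g) p.1 p.2 := by
      have hlist (g : G) : ((rule p.1 p.2).map (h' g)).prod =
          ((rule p.1 p.2).dropLast.map h).prod * g := by
        rw [hw, List.map_append, List.prod_append, ← hw,
          List.map_congr_left fun k hk => hne g k (hlt k hk)]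
        simp [h']
      simp only [rhs, hlist, hne _ _ hp1, hne _ _ hp2]
      split_ifs with he
      · exact ⟨_, (mul_inv_cancel_left _ _).symm⟩
      · simp only [← mul_assoc]
        exact ⟨_, (mul_inv_cancel_left _ _).symm⟩
    refine ⟨h' g, by rw [hne _ _ (by omega), h0], by rw [hne _ _ (by omega), h1],
      by rw [hne _ _ (by omega), h2], fun j hj => ?_, ?_⟩
    · rw [← hbig j (by omega)]
      exact Function.update_of_ne (by omega) _ _
    · intro q hq
      rw [List.take_add_one, hp, List.mem_append] at hq
      rcases hq with hq | hq
      · obtain ⟨hq1, hq2, hq3⟩ := definingPairs_lt m hm q hq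
        rw [hne _ _ hq1, hne _ _ hq2, hrel q hq]
        exact rhs_congr (hne _ _ hq1).symm (hne _ _ hq2).symm fun k hk => (hne _ _ (hq3 k hk)).symm
      · obtain rfl : q = p := by simpa using hq
        rw [hne _ _ hp1, hne _ _ hp2, hg]

/-- The word of the commutator `[x, u, u]`, where `u` and `x` are the generators `0` and `1`. -/
def commWord : List ℕ :=
  [0, 0, 0, 1, 1, 1, 0, 1, 0, 0, 0, 1, 1, 1, 0, 0, 0, 1, 0, 0]

/-- The word of the inverse of the commutator `[x, u, u]`. -/
def commInvWord : List ℕ :=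
  [0, 0, 0, 0, 0, 0, 1, 1, 1, 0, 1, 0, 1, 1, 1, 0, 0, 0, 1, 0]

theorem collect_commWord :
    eqWord (collect 20000 [] (commInvWord ++ ([2, 2, 2] ++ (commWord ++ [2]))) []).1
      (collect 20000 [] (2 :: (commInvWord ++ ([2, 2, 2] ++ commWord))) []).1 = true := by
  decide +kernel

theorem lcomm_lcomm_eq_one_iff {G : Type*} [Group G] (a x : G) :
    lcomm (lcomm a x) x = 1 ↔ a⁻¹ * x⁻¹ * a * x = x * (a⁻¹ * x⁻¹ * a) := by
  rw [lcomm, mul_assoc _ (lcomm a x), ← mul_inv_rev, inv_mul_eq_one, lcomm, ← mul_assoc x,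
    mul_left_inj]
  exact eq_comm

theorem inv_eq_pow_three {G : Type*} [Group G] (hexp : ∀ g : G, g ^ 4 = 1) (g : G) :
    g⁻¹ = g ^ 3 := by
  rw [inv_eq_iff_mul_eq_one, ← pow_succ']
  exact hexp g

/-- In a finite group of exponent four, if `u * u` is a right 2-Engel element, then so is
`[x, u, u]`. -/
theorem lcomm_lcomm_mem_R2_of_finite {Q : Type u} [Group Q] [Finite Q]
    (hexp : ∀ g : Q, g ^ 4 = 1) {u : Q} (hu : u * u ∈ R2 Q) (x y : Q) :
    lcomm (lcomm (lcomm (lcomm x u) u) y) y = 1 := by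
  obtain ⟨h, h0, h1, h2, hbig, hdef⟩ := exists_defining_relations u x y 38 le_rfl
  have hdef' : ∀ p ∈ definingPairs, h p.1 * h p.2 = rhs h p.1 p.2 := hdef
  have h3 : h 3 = u * u := by
    have := hdef' (0, 0) (by decide)
    rw [rhs, if_pos rfl, show rule (0, 0).1 (0, 0).2 = [3] from rfl] at this
    simpa [h0] using this.symm
  have hengel : ∀ g : Q, h 3 * g ^ 3 * h 3 * g = g * (h 3 * g ^ 3 * h 3) := by
    intro g
    have h4 : (u * u)⁻¹ = u * u := by
      rw [inv_eq_iff_mul_eq_one]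
      simpa [pow_succ, mul_assoc] using hexp u
    have := (lcomm_lcomm_eq_one_iff _ _).1 (hu g)
    rwa [h4, inv_eq_pow_three hexp g, ← h3] at this
  have hrel := mul_eq_rhs_of_finite _ Q rfl hexp h hbig hdef' hengel
  have hcollect (l : List ℕ) : (l.map h).prod = ((collect 20000 [] l []).1.map h).prod := by
    have := prod_mul_prod_collect (T := fun _ => (1 : Subgroup.center Q)) (fun _ => by simp)
      (fun j i hij => by rw [hrel j i hij, Subgroup.coe_one, mul_one]) 20000 [] l []
    simpa using this
  have hcomm : (commWord.map h).prod = lcomm (lcomm x u) u := by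
    simp only [lcomm, mul_inv_rev, inv_inv]
    simp only [inv_eq_pow_three hexp]
    simp [commWord, h0, h1, pow_succ, mul_assoc]
  have hinv : (commInvWord.map h).prod = (lcomm (lcomm x u) u)⁻¹ := by
    simp only [lcomm, mul_inv_rev, inv_inv]
    simp only [inv_eq_pow_three hexp]
    simp [commInvWord, h0, h1, pow_succ, mul_assoc]
  rw [lcomm_lcomm_eq_one_iff, inv_eq_pow_three hexp y, ← hinv, ← hcomm]
  have := hcollect (commInvWord ++ ([2, 2, 2] ++ (commWord ++ [2])))
  rw [eq_of_eqWord _ _ collect_commWord, ← hcollect] at this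
  simp only [List.map_append, List.prod_append, List.map_cons, List.map_nil, List.prod_cons,
    List.prod_nil, mul_one, h2, mul_assoc] at this
  simpa only [pow_succ, pow_zero, one_mul, mul_assoc] using this

end PcPresentation

open PcPresentation in
/-- In a group of exponent four, if `u * u` is a right 2-Engel element, then so is `[x, u, u]`. -/
theorem lcomm_lcomm_mem_R2 {G : Type*} [Group G] (hexp : ∀ g : G, g ^ 4 = 1) {u : G}
    (hu : u * u ∈ R2 G) (x : G) : lcomm (lcomm x u) u ∈ R2 G := by
  intro y
  have := finite_closure_triple hexp u x y
  let K := Subgroup.closure {u, x, y}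
  have hmem {g : G} (hg : g ∈ ({u, x, y} : Set G)) : g ∈ K := Subgroup.subset_closure hg
  let u' : K := ⟨u, hmem (by simp)⟩
  let x' : K := ⟨x, hmem (by simp)⟩
  let y' : K := ⟨y, hmem (by simp)⟩
  exact congrArg Subtype.val (lcomm_lcomm_mem_R2_of_finite (Q := K) (u := u')
    (fun g => Subtype.ext (hexp g)) (fun g => Subtype.ext (hu g)) x' y')

/-- Let `G` be a group of exponent 4 and `N` a normal subgroup of `G` whose underlying
set is `R₂(G)`. Then every involution `u` of `G/N` is a left 2-Engel element of `G/N`,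
i.e. `[x, u, u] = 1` for every `x ∈ G/N`. -/
theorem stmt_2 {G : Type*} [Group G] (hexp : ∀ g : G, g ^ 4 = 1)
    (N : Subgroup G) [N.Normal] (hN : (N : Set G) = R2 G) :
    ∀ u : G ⧸ N, u ^ 2 = 1 → ∀ x : G ⧸ N, lcomm (lcomm x u) u = 1 := by
  intro u hu x
  obtain ⟨u, rfl⟩ := QuotientGroup.mk_surjective u
  obtain ⟨x, rfl⟩ := QuotientGroup.mk_surjective x
  have hu' : u * u ∈ R2 G := by
    rw [← hN, ← pow_two]
    exact (QuotientGroup.eq_one_iff _).1 hu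
  have := lcomm_lcomm_mem_R2 hexp hu' x
  rw [← hN] at this
  exact (QuotientGroup.eq_one_iff _).2 this
end
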